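/- arXiv:0810.3127 — 8 statements merged into one kernel-verified Lean document; each statement's English description precedes it below -/
import Mathlib

section
/- Let X be a completely normal topological space, A a closed subset of X (with the subspace topology), and T : A → [0,1] an upper semicontinuous set-valued map whose values are nonempty closed convex subsets of [0,1]. Then there exists an upper semicontinuous set-valued map T̃ : X → [0,1] with nonempty closed convex values such that T̃(a) = T(a) for every a ∈ A. -/
/-- A set-valued map `T` is upper semicontinuous at `x₀`: for every open `V ⊆ ℝ`
with `T x₀ ⊆ V` there is an open neighborhood `U` of `x₀` with `T x ⊆ V` on `U`. -/
def SetValuedUscAt {X : Type*} [TopologicalSpace X] (T : X → Set ℝ) (x₀ : X) : Prop :=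
  ∀ V : Set ℝ, IsOpen V → T x₀ ⊆ V → ∃ U : Set X, IsOpen U ∧ x₀ ∈ U ∧ ∀ x ∈ U, T x ⊆ V

/-- A set-valued map is upper semicontinuous if it is so at every point. -/
def SetValuedUsc {X : Type*} [TopologicalSpace X] (T : X → Set ℝ) : Prop :=
  ∀ x, SetValuedUscAt T x

open Set Topology

/-- In a completely normal space, disjoint relatively open subsets of `A` are traces on `A` of
disjoint open sets. -/
theorem exists_disjoint_isOpen_preimage_eq {X : Type*} [TopologicalSpace X]
    [CompletelyNormalSpace X] {A : Set X} {F G : Set A} (hF : IsOpen F) (hG : IsOpen G)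
    (hFG : Disjoint F G) :
    ∃ U V : Set X, IsOpen U ∧ IsOpen V ∧ Disjoint U V ∧
      Subtype.val ⁻¹' U = F ∧ Subtype.val ⁻¹' V = G := by
  obtain ⟨O, hO, rfl⟩ := isOpen_induced_iff.1 hF
  obtain ⟨P, hP, rfl⟩ := isOpen_induced_iff.1 hG
  have hdisj : ∀ x ∈ A, x ∈ O → x ∉ P := fun x hx hxO hxP =>
    Set.disjoint_left.1 hFG (show (⟨x, hx⟩ : A) ∈ _ from hxO) hxP
  have hcl₁ : Disjoint (closure (A ∩ O)) (A ∩ P) :=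
    (Disjoint.closure_left (Set.disjoint_left.2 fun x hx => hdisj x hx.1 hx.2) hP).mono_right
      inter_subset_right
  have hcl₂ : Disjoint (A ∩ O) (closure (A ∩ P)) :=
    (Disjoint.closure_right (Set.disjoint_right.2 fun x hx hxO => hdisj x hx.1 hxO hx.2)
      hO).mono_left inter_subset_right
  obtain ⟨U, V, hU, hV, hAU, hAV, hUV⟩ :=
    separatedNhds_iff_disjoint.2 (completely_normal hcl₁ hcl₂)
  refine ⟨U ∩ O, V ∩ P, hU.inter hO, hV.inter hP,
    hUV.mono inter_subset_left inter_subset_left, ?_, ?_⟩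
  · ext a
    exact ⟨fun h => h.2, fun h => ⟨hAU ⟨a.2, h⟩, h⟩⟩
  · ext a
    exact ⟨fun h => h.2, fun h => ⟨hAV ⟨a.2, h⟩, h⟩⟩

/-- A countable version of `exists_disjoint_isOpen_preimage_eq`: from an antitone family `F` and a
monotone family `G` of relatively open sets with `F i` and `G i` disjoint, one gets open extensions
such that the extensions of `G i` and `F j` are disjoint whenever `i ≤ j`. -/
theorem exists_isOpen_preimage_eq_of_antitone_of_monotone {X ι : Type*} [TopologicalSpace X]
    [CompletelyNormalSpace X] [Preorder ι] [Countable ι] {A : Set X} {F G : ι → Set A}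
    (hF : ∀ i, IsOpen (F i)) (hG : ∀ i, IsOpen (G i)) (hF_anti : Antitone F)
    (hG_mono : Monotone G) (hFG : ∀ i, Disjoint (F i) (G i)) :
    ∃ U V : ι → Set X, (∀ i, IsOpen (U i)) ∧ (∀ i, IsOpen (V i)) ∧
      (∀ i, Subtype.val ⁻¹' U i = F i) ∧ (∀ i, Subtype.val ⁻¹' V i = G i) ∧
      ∀ i j, i ≤ j → Disjoint (V i) (U j) := by
  choose U V hU hV hUV hUF hVG using
    fun i => exists_disjoint_isOpen_preimage_eq (hF i) (hG i) (hFG i)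
  obtain ⟨c, hc⟩ := exists_injective_nat ι
  have hfin : ∀ n, {k | c k ≤ n}.Finite := fun n =>
    (Set.finite_Iic n).preimage hc.injOn
  refine ⟨fun n => U n ∩ ⋂ k ∈ {k | c k ≤ c n ∧ k ≤ n}, (closure (V k))ᶜ,
    fun n => V n ∩ ⋂ k ∈ {k | c k ≤ c n ∧ n ≤ k}, (closure (U k))ᶜ,
    fun n => ?_, fun n => ?_, fun n => ?_, fun n => ?_, fun i j hij => ?_⟩
  · exact (hU n).inter <| ((hfin (c n)).subset fun k hk => hk.1).isOpen_biInter
      fun k _ => isClosed_closure.isOpen_compl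
  · exact (hV n).inter <| ((hfin (c n)).subset fun k hk => hk.1).isOpen_biInter
      fun k _ => isClosed_closure.isOpen_compl
  · rw [preimage_inter, hUF, inter_eq_left]
    intro a ha
    simp only [mem_preimage, mem_iInter, mem_compl_iff]
    intro k hk
    have haU : a ∈ Subtype.val ⁻¹' U k := hUF k ▸ hF_anti hk.2 ha
    exact Set.disjoint_left.1 ((hUV k).closure_right (hU k)) haU
  · rw [preimage_inter, hVG, inter_eq_left]
    intro a ha
    simp only [mem_preimage, mem_iInter, mem_compl_iff]
    intro k hk
    have haV : a ∈ Subtype.val ⁻¹' V k := hVG k ▸ hG_mono hk.2 ha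
    exact Set.disjoint_right.1 ((hUV k).closure_left (hV k)) haV
  · refine Set.disjoint_left.2 fun x hxV hxU => ?_
    have hxV' := mem_iInter₂.1 hxV.2
    have hxU' := mem_iInter₂.1 hxU.2
    rcases le_total (c i) (c j) with h | h
    · exact hxU' i ⟨h, hij⟩ (subset_closure hxV.1)
    · exact hxV' j ⟨h, hij⟩ (subset_closure hxU.1)

/-- Cutting a compact set by closed constraints `C i`, each imposed on an open set `W i`, gives an
upper semicontinuous map. -/
theorem setValuedUsc_inter_iInter {X ι : Type*} [TopologicalSpace X] {K : Set ℝ}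
    (hK : IsCompact K) {W : ι → Set X} (hW : ∀ i, IsOpen (W i)) {C : ι → Set ℝ}
    (hC : ∀ i, IsClosed (C i)) :
    SetValuedUsc fun x => K ∩ ⋂ i, ⋂ (_ : x ∈ W i), C i := by
  intro x V hV hxV
  obtain ⟨u, hu⟩ := (hK.diff hV).elim_finite_subfamily_closed
    (fun i : {i // x ∈ W i} => C i) (fun i => hC i) <| by
      rw [Set.eq_empty_iff_forall_notMem]
      rintro y ⟨⟨hyK, hyV⟩, hy⟩
      exact hyV (hxV ⟨hyK, mem_iInter₂.2 fun i hi => mem_iInter.1 hy ⟨i, hi⟩⟩)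
  refine ⟨⋂ i ∈ u, W i, isOpen_biInter_finset fun i _ => hW i,
    mem_iInter₂.2 fun i _ => i.2, fun x' hx' y hy => ?_⟩
  by_contra hyV
  have hmem : y ∈ (K \ V) ∩ ⋂ i ∈ u, C i := ⟨⟨hy.1, hyV⟩, mem_iInter₂.2 fun i hi =>
    mem_iInter₂.1 hy.2 i (mem_iInter₂.1 hx' i hi)⟩
  rw [hu] at hmem
  exact hmem

theorem SetValuedUsc.isOpen_setOf_subset {X : Type*} [TopologicalSpace X] {T : X → Set ℝ}
    (hT : SetValuedUsc T) {V : Set ℝ} (hV : IsOpen V) : IsOpen {x | T x ⊆ V} :=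
  isOpen_iff_forall_mem_open.2 fun x hx =>
    let ⟨U, hU, hxU, hUV⟩ := hT x V hV hx
    ⟨U, hUV, hU, hxU⟩

/-- Extension of usc set-valued maps with nonempty closed convex
values in `[0,1]` from a closed subset of a completely normal (Hausdorff) space. -/
theorem usc_extension_of_completelyNormal
    {X : Type*} [TopologicalSpace X] [T5Space X]
    {A : Set X} (hA : IsClosed A) (T : A → Set ℝ)
    (hTusc : SetValuedUsc T)
    (hTsub : ∀ a, T a ⊆ Set.Icc (0 : ℝ) 1)
    (hTne : ∀ a, (T a).Nonempty)
    (hTcl : ∀ a, IsClosed (T a))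
    (hTconv : ∀ a, Convex ℝ (T a)) :
    ∃ T' : X → Set ℝ, SetValuedUsc T' ∧
      (∀ x, T' x ⊆ Set.Icc (0 : ℝ) 1) ∧
      (∀ x, (T' x).Nonempty) ∧
      (∀ x, IsClosed (T' x)) ∧
      (∀ x, Convex ℝ (T' x)) ∧
      (∀ a : A, T' (a : X) = T a) := by
  let ι := {q : ℚ // (q : ℝ) ∈ Icc (0 : ℝ) 1}
  obtain ⟨U, V, hU, hV, hUT, hVT, hVU⟩ :=
    exists_isOpen_preimage_eq_of_antitone_of_monotone (ι := ι)
      (F := fun q => {a | T a ⊆ Ioi (q.1 : ℝ)}) (G := fun q => {a | T a ⊆ Iio (q.1 : ℝ)})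
      (fun q => hTusc.isOpen_setOf_subset isOpen_Ioi)
      (fun q => hTusc.isOpen_setOf_subset isOpen_Iio)
      (fun p q hpq a ha => Subset.trans ha (Ioi_subset_Ioi (Rat.cast_le.2 hpq)))
      (fun p q hpq a ha => Subset.trans ha (Iio_subset_Iio (Rat.cast_le.2 hpq)))
      (fun q => Set.disjoint_left.2 fun a h₁ h₂ =>
        let ⟨_, hy⟩ := hTne a
        lt_asymm (mem_Ioi.1 (h₁ hy)) (mem_Iio.1 (h₂ hy)))
  have hmemU : ∀ (a : A) q, (a : X) ∈ U q ↔ T a ⊆ Ioi (q.1 : ℝ) := fun a q =>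
    Set.ext_iff.1 (hUT q) a
  have hmemV : ∀ (a : A) q, (a : X) ∈ V q ↔ T a ⊆ Iio (q.1 : ℝ) := fun a q =>
    Set.ext_iff.1 (hVT q) a
  let W : ι ⊕ ι → Set X := Sum.elim U V
  let C : ι ⊕ ι → Set ℝ := Sum.elim (fun q => Ici (q.1 : ℝ)) (fun q => Iic (q.1 : ℝ))
  have hW : ∀ i, IsOpen (W i) := Sum.rec hU hV
  have hC : ∀ i, IsClosed (C i) := Sum.rec (fun _ => isClosed_Ici) (fun _ => isClosed_Iic)
  have hCconv : ∀ i, Convex ℝ (C i) :=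
    Sum.rec (fun _ => convex_Ici _) (fun _ => convex_Iic _)
  refine ⟨fun x => Icc (0 : ℝ) 1 ∩ ⋂ i, ⋂ (_ : x ∈ W i), C i,
    setValuedUsc_inter_iInter isCompact_Icc hW hC, fun x => inter_subset_left, fun x => ?_,
    fun x => isClosed_Icc.inter <| isClosed_iInter fun i => isClosed_iInter fun _ => hC i,
    fun x => (convex_Icc 0 1).inter <| convex_iInter fun i => convex_iInter fun _ => hCconv i,
    fun a => ?_⟩
  · obtain ⟨y, hyL, hyR⟩ := exists_between_of_forall_le
      (s := insert (0 : ℝ) ((fun q : ι => (q.1 : ℝ)) '' {q | x ∈ U q}))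
      (t := insert (1 : ℝ) ((fun q : ι => (q.1 : ℝ)) '' {q | x ∈ V q}))
      (insert_nonempty _ _) (insert_nonempty _ _) <| by
        rintro _ (rfl | ⟨p, hp, rfl⟩) _ (rfl | ⟨q, hq, rfl⟩)
        · exact zero_le_one
        · exact q.2.1
        · exact p.2.2
        · by_contra! hlt
          exact Set.disjoint_left.1 (hVU q p (Rat.cast_lt.1 hlt).le) hq hp
    refine ⟨y, ⟨hyL (mem_insert _ _), hyR (mem_insert _ _)⟩, mem_iInter₂.2 ?_⟩
    rintro (q | q) hq
    · exact hyL (mem_insert_of_mem _ ⟨q, hq, rfl⟩)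
    · exact hyR (mem_insert_of_mem _ ⟨q, hq, rfl⟩)
  · have hTcomp : IsCompact (T a) := isCompact_Icc.of_isClosed_subset (hTcl a) (hTsub a)
    refine Subset.antisymm (fun y hy => ?_) fun y hy => ⟨hTsub a hy, mem_iInter₂.2 ?_⟩
    · obtain ⟨⟨hy0, hy1⟩, hyC⟩ := hy
      rw [mem_iInter₂] at hyC
      obtain ⟨m, hm⟩ := hTcomp.exists_isLeast (hTne a)
      obtain ⟨M, hM⟩ := hTcomp.exists_isGreatest (hTne a)
      refine (hTconv a).ordConnected.out hm.1 hM.1 ⟨?_, ?_⟩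
      · by_contra! hlt
        obtain ⟨q, hyq, hqm⟩ := exists_rat_btwn hlt
        let q' : ι := ⟨q, hy0.trans hyq.le, hqm.le.trans (hTsub a hm.1).2⟩
        exact hyq.not_ge <|
          hyC (Sum.inl q') ((hmemU a q').2 fun z hz => hqm.trans_le (hm.2 hz))
      · by_contra! hlt
        obtain ⟨q, hMq, hqy⟩ := exists_rat_btwn hlt
        let q' : ι := ⟨q, (hTsub a hM.1).1.trans hMq.le, hqy.le.trans hy1⟩
        exact hqy.not_ge <|
          hyC (Sum.inr q') ((hmemV a q').2 fun z hz => (hM.2 hz).trans_lt hMq)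
    · rintro (q | q) hq
      · exact le_of_lt (mem_Ioi.1 ((hmemU a q).1 hq hy))
      · exact le_of_lt (mem_Iio.1 ((hmemV a q).1 hq hy))
end

section
/- Let X be a completely normal topological space and A a closed subset of X. Let f, g : A → [0,1] be functions such that f is lower semicontinuous, g is upper semicontinuous, and f(x) ≤ g(x) for every x ∈ A. Then there exist functions f̃, g̃ : X → [0,1] with f̃ lower semicontinuous, g̃ upper semicontinuous, f̃(x) ≤ g̃(x) for every x ∈ X, and f̃(a) = f(a), g̃(a) = g(a) for every a ∈ A. -/
open Set

/-- In a completely normal space, a decreasing family `U` and an increasing family `L`, indexed by a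
countable linear order, with `U i` and `L i` separated for all `i`, can be enlarged to open families
such that the enlargements of `U i` and `L j` are disjoint for `j ≤ i`. -/
theorem exists_isOpen_families_disjoint {ι X : Type*} [LinearOrder ι] [Countable ι]
    [TopologicalSpace X] [CompletelyNormalSpace X] {U L : ι → Set X}
    (hU : Antitone U) (hL : Monotone L)
    (h₁ : ∀ i, Disjoint (closure (U i)) (L i)) (h₂ : ∀ i, Disjoint (U i) (closure (L i))) :
    ∃ V W : ι → Set X, (∀ i, IsOpen (V i)) ∧ (∀ i, IsOpen (W i)) ∧
      (∀ i, U i ⊆ V i) ∧ (∀ i, L i ⊆ W i) ∧ ∀ i j, j ≤ i → Disjoint (V i) (W j) := by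
  have key (i : ι) : SeparatedNhds (U i) (L i) :=
    separatedNhds_iff_disjoint.2 (completely_normal (h₁ i) (h₂ i))
  choose O P hO hP hUO hLP hOP using key
  obtain ⟨e, he⟩ := exists_injective_nat ι
  have hfin (i : ι) : {j | e j < e i}.Finite :=
    (finite_Iio (e i)).preimage he.injOn
  refine ⟨fun i => O i \ ⋃ j ∈ {j | e j < e i} ∩ Iic i, closure (P j),
    fun i => P i \ ⋃ j ∈ {j | e j < e i} ∩ Ici i, closure (O j), fun i => ?_, fun i => ?_,
    fun i x hx => ⟨hUO i hx, ?_⟩, fun i x hx => ⟨hLP i hx, ?_⟩, fun i j hji => ?_⟩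
  · exact (hO i).sdiff (((hfin i).inter_of_left _).isClosed_biUnion fun _ _ => isClosed_closure)
  · exact (hP i).sdiff (((hfin i).inter_of_left _).isClosed_biUnion fun _ _ => isClosed_closure)
  · simp only [mem_iUnion, not_exists]
    intro j hj hxj
    exact ((hOP j).closure_right (hO j)).le_bot ⟨hUO j (hU hj.2 hx), hxj⟩
  · simp only [mem_iUnion, not_exists]
    intro j hj hxj
    exact ((hOP j).closure_left (hP j)).le_bot ⟨hxj, hLP j (hL hj.2 hx)⟩
  · rw [disjoint_left]
    rintro x ⟨hxO, hx⟩ ⟨hxP, hx'⟩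
    simp only [mem_iUnion, not_exists] at hx hx'
    rcases lt_trichotomy (e i) (e j) with h | h | h
    · exact hx' i ⟨h, hji⟩ (subset_closure hxO)
    · obtain rfl := he h
      exact (hOP i).le_bot ⟨hxO, hxP⟩
    · exact hx j ⟨h, hji⟩ (subset_closure hxP)

/-- A `[0,1]`-valued function on a subset, whose strict superlevel sets at rational levels are the
traces of open sets `V q`, extends to a lower semicontinuous function built from the `V q`. -/
theorem exists_lowerSemicontinuous_extension {X : Type*} [TopologicalSpace X] {A : Set X}
    {f : A → ℝ} (hf : ∀ a, f a ∈ Icc (0 : ℝ) 1) {V : ℚ → Set X} (hV : ∀ q, IsOpen (V q))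
    (hVf : ∀ (a : A) (q : ℚ), (a : X) ∈ V q ↔ (q : ℝ) < f a) :
    ∃ f' : X → ℝ, LowerSemicontinuous f' ∧ (∀ x, f' x ∈ Icc (0 : ℝ) 1) ∧
      (∀ a : A, f' a = f a) ∧
      ∀ x c, 0 ≤ c → (∀ q : ℚ, x ∈ V q → max 0 (min (q : ℝ) 1) ≤ c) → f' x ≤ c := by
  set φ : ℚ → X → ℝ := fun q => (V q).indicator fun _ => max 0 (min (q : ℝ) 1) with hφ
  have hφle {x : X} {c : ℝ} (hc : 0 ≤ c)
      (h : ∀ q : ℚ, x ∈ V q → max 0 (min (q : ℝ) 1) ≤ c) (q : ℚ) : φ q x ≤ c := by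
    by_cases hx : x ∈ V q
    · simpa [hφ, hx] using h q hx
    · simpa [hφ, hx] using hc
  have hφ1 (x : X) (q : ℚ) : φ q x ≤ 1 := hφle zero_le_one (fun q _ => by simp) q
  have hbdd (x : X) : BddAbove (range fun q => φ q x) := ⟨1, by rintro _ ⟨q, rfl⟩; exact hφ1 x q⟩
  have hle (x : X) (q : ℚ) : φ q x ≤ ⨆ q, φ q x := le_ciSup (hbdd x) q
  have hnonneg (x : X) : 0 ≤ ⨆ q, φ q x :=
    (indicator_nonneg (fun _ _ => le_max_left _ _) x).trans (hle x 0)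
  refine ⟨fun x => ⨆ q, φ q x, ?_, fun x => ⟨hnonneg x, ciSup_le (hφ1 x)⟩, fun a => ?_,
    fun x c hc h => ciSup_le (hφle hc h)⟩
  · exact lowerSemicontinuous_ciSup hbdd fun q =>
      (hV q).lowerSemicontinuous_indicator (le_max_left _ _)
  · refine le_antisymm (ciSup_le (hφle (hf a).1 fun q hq => ?_)) (le_of_forall_lt fun b hb => ?_)
    · exact max_le (hf a).1 ((min_le_left _ _).trans ((hVf a q).1 hq).le)
    · obtain ⟨q, hbq, hqf⟩ := exists_rat_btwn hb
      refine hbq.trans_le (le_trans ?_ (hle a q))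
      simp only [hφ, indicator_of_mem ((hVf a q).2 hqf)]
      rw [min_eq_left (hqf.le.trans (hf a).2)]
      exact le_max_right _ _

/-- Simultaneous extension of an lsc function `f` and a usc function
`g` with `f ≤ g`, both with values in `[0,1]`, from a closed subset of a completely
normal (Hausdorff) space, preserving semicontinuity and the inequality. -/
theorem semicontinuous_extension_of_completelyNormal
    {X : Type*} [TopologicalSpace X] [T5Space X]
    {A : Set X} (hA : IsClosed A) (f g : A → ℝ)
    (hf01 : ∀ a, f a ∈ Set.Icc (0 : ℝ) 1)
    (hg01 : ∀ a, g a ∈ Set.Icc (0 : ℝ) 1)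
    (hf : LowerSemicontinuous f)
    (hg : UpperSemicontinuous g)
    (hfg : ∀ a, f a ≤ g a) :
    ∃ f' g' : X → ℝ,
      LowerSemicontinuous f' ∧ UpperSemicontinuous g' ∧
      (∀ x, f' x ∈ Set.Icc (0 : ℝ) 1) ∧ (∀ x, g' x ∈ Set.Icc (0 : ℝ) 1) ∧
      (∀ x, f' x ≤ g' x) ∧
      (∀ a : A, f' (a : X) = f a) ∧ (∀ a : A, g' (a : X) = g a) := by
  have hUc (q : ℚ) : IsClosed (Subtype.val '' {a | f a ≤ q} : Set X) :=
    hA.isClosedEmbedding_subtypeVal.isClosedMap _ (hf.isClosed_preimage q)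
  have hLc (q : ℚ) : IsClosed (Subtype.val '' {a | (q : ℝ) ≤ g a} : Set X) :=
    hA.isClosedEmbedding_subtypeVal.isClosedMap _ (hg.isClosed_preimage q)
  obtain ⟨V, W, hV, hW, hUV, hLW, hVW⟩ := exists_isOpen_families_disjoint
    (U := fun q : ℚ => (Subtype.val '' {a | (q : ℝ) < f a} : Set X))
    (L := fun q : ℚ => (Subtype.val '' {a | g a < q} : Set X))
    (fun p q hpq => image_mono fun a (ha : (q : ℝ) < f a) =>
      (Rat.cast_le.2 hpq).trans_lt ha)
    (fun p q hpq => image_mono fun a (ha : g a < p) =>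
      ha.trans_le (Rat.cast_le.2 hpq))
    (fun q => by
      refine Disjoint.mono_left (closure_minimal (image_mono fun a ha => ?_) (hLc q)) ?_
      · exact (le_of_lt ha).trans (hfg a)
      · exact (disjoint_image_iff Subtype.val_injective).2 <| disjoint_left.2
          fun a (h : (q : ℝ) ≤ g a) (h' : g a < q) => h'.not_ge h)
    (fun q => by
      refine Disjoint.mono_right (closure_minimal (image_mono fun a ha => ?_) (hUc q)) ?_
      · exact (hfg a).trans (le_of_lt ha)
      · exact (disjoint_image_iff Subtype.val_injective).2 <| disjoint_left.2
          fun a (h : (q : ℝ) < f a) (h' : f a ≤ q) => h.not_ge h')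
  obtain ⟨f', hf', hf'01, hf'A, hf'le⟩ := exists_lowerSemicontinuous_extension hf01
    (V := fun q => V q \ Subtype.val '' {a | f a ≤ q}) (fun q => (hV q).sdiff (hUc q))
    (fun a q => by
      have := @hUV q a
      simp only [mem_sdiff, Subtype.val_injective.mem_set_image,
        mem_ofPred_eq, not_le] at this ⊢
      exact ⟨fun h => h.2, fun h => ⟨this h, h⟩⟩)
  obtain ⟨h', hh', hh'01, hh'A, hh'le⟩ := exists_lowerSemicontinuous_extension
    (f := fun a => 1 - g a) (fun a => ⟨sub_nonneg.2 (hg01 a).2, sub_le_self _ (hg01 a).1⟩)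
    (V := fun q => W (1 - q) \ Subtype.val '' {a | ((1 - q : ℚ) : ℝ) ≤ g a})
    (fun q => (hW _).sdiff (hLc _))
    (fun a q => by
      have hcast : (q : ℝ) < 1 - g a ↔ g a < ((1 - q : ℚ) : ℝ) := by
        rw [lt_sub_comm, Rat.cast_sub, Rat.cast_one]
      have := @hLW (1 - q) a
      simp only [mem_sdiff, Subtype.val_injective.mem_set_image,
        mem_ofPred_eq, not_le] at this ⊢
      rw [hcast]
      exact ⟨fun h => h.2, fun h => ⟨this h, h⟩⟩)
  refine ⟨f', fun x => 1 - h' x, hf', ?_, hf'01,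
    fun x => ⟨sub_nonneg.2 (hh'01 x).2, sub_le_self _ (hh'01 x).1⟩, fun x => ?_, hf'A,
    fun a => by simp [hh'A]⟩
  · exact (continuous_const.sub continuous_id).comp_lowerSemicontinuous_antitone hh'
      fun a b hab => sub_le_sub_left hab 1
  · refine hf'le x _ (sub_nonneg.2 (hh'01 x).2) fun q hq => le_sub_comm.1 ?_
    refine hh'le x _ (by simp) fun p hp => ?_
    have hlt : q < 1 - p := by
      by_contra! hle
      exact (hVW q (1 - p) hle).le_bot ⟨hq.1, hp.1⟩
    have hlt' : (q : ℝ) < 1 - p := by exact_mod_cast hlt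
    grind
end

section
/- Let X be a normal Hausdorff topological space and A a closed subset of X such that A (with the subspace topology) is perfectly normal. Let f, g : A → [0,1] be functions such that f is lower semicontinuous, g is upper semicontinuous, and f(x) ≤ g(x) for every x ∈ A. Then there exist functions f̃, g̃ : X → [0,1] with f̃ lower semicontinuous, g̃ upper semicontinuous, f̃(x) ≤ g̃(x) for every x ∈ X, and f̃(a) = f(a), g̃(a) = g(a) for every a ∈ A. -/
open Set in
/-- On a perfectly normal space, a nonnegative lower semicontinuous function is the pointwise
supremum of a sequence of nonnegative continuous functions. -/
theorem LowerSemicontinuous.exists_seq_continuousMap_isLUB {Y : Type*} [TopologicalSpace Y]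
    [PerfectlyNormalSpace Y] {f : Y → ℝ} (hf : LowerSemicontinuous f) (hf0 : ∀ y, 0 ≤ f y) :
    ∃ φ : ℕ → C(Y, ℝ), (∀ n y, 0 ≤ φ n y) ∧ ∀ y, IsLUB (range fun n => φ n y) (f y) := by
  choose ψ hψ hψ01 using fun q : ℚ≥0 =>
    perfectlyNormalSpace_iff_forall_isClosed_preimage_zero.1 ‹_› (f ⁻¹' Iic (q : ℝ))
      (hf.isClosed_preimage q)
  have hψ_zero (q : ℚ≥0) (y : Y) : f y ≤ q ↔ ψ q y = 0 := Set.ext_iff.1 (hψ q) y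
  let Φ : ℚ≥0 × ℕ → C(Y, ℝ) := fun p =>
    ⟨fun y => p.1 * min 1 (p.2 * ψ p.1 y), by fun_prop⟩
  have hΦ0 (p : ℚ≥0 × ℕ) (y : Y) : 0 ≤ Φ p y :=
    mul_nonneg p.1.cast_nonneg
      (le_min zero_le_one (mul_nonneg p.2.cast_nonneg (hψ01 p.1 y).1))
  have hΦ (y : Y) : IsLUB (range fun p => Φ p y) (f y) := by
    refine ⟨?_, fun b hb => le_of_not_gt fun hbf => ?_⟩
    · rintro _ ⟨⟨q, n⟩, rfl⟩
      rcases le_or_gt (f y) q with h | h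
      · simpa [Φ, (hψ_zero q y).1 h] using hf0 y
      · exact (mul_le_of_le_one_right q.cast_nonneg (min_le_left _ _)).trans h.le
    · have hb0 : 0 ≤ b := (hΦ0 (0, 0) y).trans (hb ⟨_, rfl⟩)
      obtain ⟨q, hbq, hqf⟩ := exists_rat_btwn hbf
      lift q to ℚ≥0 using by exact_mod_cast hb0.trans hbq.le
      have hψ_pos : 0 < ψ q y := (hψ01 q y).1.lt_of_ne fun h =>
        hqf.not_ge (by simpa using (hψ_zero q y).2 h.symm)
      obtain ⟨n, hn⟩ := exists_nat_gt (1 / ψ q y)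
      have hle : Φ (q, n) y ≤ b := hb ⟨_, rfl⟩
      have hn' : 1 ≤ n * ψ q y := ((div_lt_iff₀ hψ_pos).1 hn).le
      simp only [Φ, ContinuousMap.coe_mk, min_eq_left hn', mul_one] at hle
      exact hle.not_gt (by simpa using hbq)
  obtain ⟨e, he⟩ := exists_surjective_nat (ℚ≥0 × ℕ)
  refine ⟨fun n => Φ (e n), fun n => hΦ0 (e n), fun y => ?_⟩
  have := he.range_comp fun p => Φ p y
  exact this ▸ hΦ y

open Set in
/-- On a perfectly normal space, an upper semicontinuous function bounded above by `1` is the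
pointwise infimum of a sequence of continuous functions bounded above by `1`. -/
theorem UpperSemicontinuous.exists_seq_continuousMap_isGLB {Y : Type*} [TopologicalSpace Y]
    [PerfectlyNormalSpace Y] {g : Y → ℝ} (hg : UpperSemicontinuous g) (hg1 : ∀ y, g y ≤ 1) :
    ∃ γ : ℕ → C(Y, ℝ), (∀ n y, γ n y ≤ 1) ∧ ∀ y, IsGLB (range fun n => γ n y) (g y) := by
  have hlsc : LowerSemicontinuous fun y => 1 - g y := fun y t ht => by
    filter_upwards [hg y (1 - t) (by linarith)] with z hz
    linarith
  obtain ⟨φ, hφ0, hφ⟩ := hlsc.exists_seq_continuousMap_isLUB fun y => sub_nonneg.2 (hg1 y)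
  refine ⟨fun n => 1 - φ n, fun n y => by simpa using hφ0 n y, fun y => ⟨?_, fun b hb => ?_⟩⟩
  · rintro _ ⟨n, rfl⟩
    have := (hφ y).1 ⟨n, rfl⟩
    simp only [ContinuousMap.sub_apply, ContinuousMap.one_apply] at this ⊢
    linarith
  · have : 1 - g y ≤ 1 - b := (hφ y).2 <| by
      rintro _ ⟨n, rfl⟩
      have := hb ⟨n, rfl⟩
      simp only [ContinuousMap.sub_apply, ContinuousMap.one_apply] at this ⊢
      linarith
    linarith

open Set Finset in
/-- Given two sequences of continuous functions `F` and `G`, the functions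
`⨆ n, min (F n) (min_{k ≤ n} G k)` and `⨅ n, max (G n) (max_{k ≤ n} F k)` are ordered, and they
agree with `⨆ n, F n` and `⨅ n, G n` wherever `F k ≤ G l` for all `k` and `l`. -/
theorem exists_lowerSemicontinuous_le_upperSemicontinuous {X : Type*} [TopologicalSpace X]
    (F G : ℕ → C(X, ℝ)) {a b : ℝ} (hF : ∀ n x, F n x ∈ Set.Icc a b)
    (hG : ∀ n x, G n x ∈ Set.Icc a b) :
    ∃ f g : X → ℝ, LowerSemicontinuous f ∧ UpperSemicontinuous g ∧
      (∀ x, f x ∈ Set.Icc a b) ∧ (∀ x, g x ∈ Set.Icc a b) ∧ (∀ x, f x ≤ g x) ∧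
      ∀ x, (∀ k l, F k x ≤ G l x) → f x = ⨆ n, F n x ∧ g x = ⨅ n, G n x := by
  let u (n : ℕ) (x : X) : ℝ := min (F n x) ((range (n + 1)).inf' nonempty_range_add_one (G · x))
  let v (n : ℕ) (x : X) : ℝ := max (G n x) ((range (n + 1)).sup' nonempty_range_add_one (F · x))
  have hu (n : ℕ) : Continuous (u n) :=
    (F n).continuous.min (Continuous.finset_inf'_apply _ fun i _ => (G i).continuous)
  have hv (n : ℕ) : Continuous (v n) :=
    (G n).continuous.max (Continuous.finset_sup'_apply _ fun i _ => (F i).continuous)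
  have hu_mem (n : ℕ) (x : X) : u n x ∈ Set.Icc a b :=
    ⟨le_min (hF n x).1 (le_inf' _ _ fun k _ => (hG k x).1), (min_le_left _ _).trans (hF n x).2⟩
  have hv_mem (n : ℕ) (x : X) : v n x ∈ Set.Icc a b :=
    ⟨(hG n x).1.trans (le_max_left _ _), max_le (hG n x).2 (sup'_le _ _ fun k _ => (hF k x).2)⟩
  have huv (n m : ℕ) (x : X) : u n x ≤ v m x := by
    rcases le_total n m with h | h
    · exact (min_le_left _ _).trans
        ((le_sup' (F · x) (mem_range_succ_iff.2 h)).trans (le_max_right _ _))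
    · exact (min_le_right _ _).trans
        ((inf'_le (G · x) (mem_range_succ_iff.2 h)).trans (le_max_left _ _))
  have hu_bdd (x : X) : BddAbove (Set.range fun n => u n x) :=
    ⟨b, Set.forall_mem_range.2 fun n => (hu_mem n x).2⟩
  have hv_bdd (x : X) : BddBelow (Set.range fun n => v n x) :=
    ⟨a, Set.forall_mem_range.2 fun n => (hv_mem n x).1⟩
  refine ⟨fun x => ⨆ n, u n x, fun x => ⨅ n, v n x,
    lowerSemicontinuous_ciSup hu_bdd fun n => (hu n).lowerSemicontinuous,
    upperSemicontinuous_ciInf hv_bdd fun n => (hv n).upperSemicontinuous,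
    fun x => ⟨(hu_mem 0 x).1.trans (le_ciSup (hu_bdd x) 0), ciSup_le fun n => (hu_mem n x).2⟩,
    fun x => ⟨le_ciInf fun n => (hv_mem n x).1, (ciInf_le (hv_bdd x) 0).trans (hv_mem 0 x).2⟩,
    fun x => ciSup_le fun n => le_ciInf fun m => huv n m x, fun x hx => ⟨?_, ?_⟩⟩
  · exact iSup_congr fun n => min_eq_left (le_inf' _ _ fun k _ => hx n k)
  · exact iInf_congr fun n => max_eq_left (sup'_le _ _ fun k _ => hx k n)


/-- Simultaneous extension of an lsc function `f` and a usc function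
`g` with `f ≤ g`, both with values in `[0,1]`, from a closed, perfectly normal subset
of a normal Hausdorff space, preserving semicontinuity and the inequality. -/
theorem semicontinuous_extension_of_normal_of_perfectlyNormal_subset
    {X : Type*} [TopologicalSpace X] [T2Space X] [NormalSpace X]
    {A : Set X} (hA : IsClosed A) [T6Space A] (f g : A → ℝ)
    (hf01 : ∀ a, f a ∈ Set.Icc (0 : ℝ) 1)
    (hg01 : ∀ a, g a ∈ Set.Icc (0 : ℝ) 1)
    (hf : LowerSemicontinuous f)
    (hg : UpperSemicontinuous g)
    (hfg : ∀ a, f a ≤ g a) :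
    ∃ f' g' : X → ℝ,
      LowerSemicontinuous f' ∧ UpperSemicontinuous g' ∧
      (∀ x, f' x ∈ Set.Icc (0 : ℝ) 1) ∧ (∀ x, g' x ∈ Set.Icc (0 : ℝ) 1) ∧
      (∀ x, f' x ≤ g' x) ∧
      (∀ a : A, f' (a : X) = f a) ∧ (∀ a : A, g' (a : X) = g a) := by
  obtain ⟨φ, hφ0, hφ⟩ := hf.exists_seq_continuousMap_isLUB fun a => (hf01 a).1
  obtain ⟨γ, hγ1, hγ⟩ := hg.exists_seq_continuousMap_isGLB fun a => (hg01 a).2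
  have hφf (n : ℕ) (a : A) : φ n a ≤ f a := (hφ a).1 ⟨n, rfl⟩
  have hgγ (n : ℕ) (a : A) : g a ≤ γ n a := (hγ a).1 ⟨n, rfl⟩
  choose F hF hFφ using fun n => (φ n).exists_restrict_eq_forall_mem_of_closed (t := Set.Icc 0 1)
    (fun a => ⟨hφ0 n a, (hφf n a).trans (hf01 a).2⟩) (Set.nonempty_Icc.2 zero_le_one) hA
  choose G hG hGγ using fun n => (γ n).exists_restrict_eq_forall_mem_of_closed (t := Set.Icc 0 1)
    (fun a => ⟨(hg01 a).1.trans (hgγ n a), hγ1 n a⟩) (Set.nonempty_Icc.2 zero_le_one) hA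
  replace hFφ (n : ℕ) (a : A) : F n a = φ n a := DFunLike.congr_fun (hFφ n) a
  replace hGγ (n : ℕ) (a : A) : G n a = γ n a := DFunLike.congr_fun (hGγ n) a
  obtain ⟨f', g', hf', hg', hf'_mem, hg'_mem, hfg', heq⟩ :=
    exists_lowerSemicontinuous_le_upperSemicontinuous F G hF hG
  have hFG (a : A) (k l : ℕ) : F k a ≤ G l a := by
    rw [hFφ, hGγ]
    exact (hφf k a).trans ((hfg a).trans (hgγ l a))
  refine ⟨f', g', hf', hg', hf'_mem, hg'_mem, hfg', fun a => ?_, fun a => ?_⟩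
  · rw [(heq a (hFG a)).1]
    simpa only [hFφ] using (hφ a).ciSup_eq
  · rw [(heq a (hFG a)).2]
    simpa only [hGγ] using (hγ a).ciInf_eq
end

section
/- Let I be an arbitrary index set and for each α ∈ I let X_α = [0,1], and let X = ∏_{λ∈I} X_λ carry the product topology. For each α ∈ I, let T_α : X → [0,1] be an upper semicontinuous set-valued map whose values are (possibly empty) closed convex subsets of [0,1], and suppose that Dom(T_α) = {x ∈ X : T_α(x) ≠ ∅}, with the subspace topology, is perfectly normal. Then there exists x ∈ X such that for every α ∈ I, either x_α ∈ T_α(x) or T_α(x) = ∅. -/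
open Set Topology

theorem exists_seq_continuous_lower_support {Y : Type*} [TopologicalSpace Y]
    [PerfectlyNormalSpace Y] {T : Y → Set ℝ} (hT : SetValuedUsc T)
    (hcpt : ∀ x, IsCompact (T x)) (hne : ∀ x, (T x).Nonempty) (hb : ∀ x, T x ⊆ Ici (-1)) :
    ∃ f : ℕ → C(Y, ℝ), (∀ n x, ∀ y ∈ T x, f n x ≤ y) ∧
      ∀ x c, T x ⊆ Ioi c → ∃ n, c < f n x := by
  have hopen (q : ℚ) : IsOpen {x | T x ⊆ Ioi (q : ℝ)} := by
    refine isOpen_iff_forall_mem_open.2 fun x hx => ?_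
    obtain ⟨U, hU, hxU, h⟩ := hT x (Ioi (q : ℝ)) isOpen_Ioi hx
    exact ⟨U, h, hU, hxU⟩
  choose φ hφ hφ01 using fun q : ℚ =>
    perfectlyNormalSpace_iff_forall_isClosed_preimage_zero.1 ‹PerfectlyNormalSpace Y› _
      (hopen q).isClosed_compl
  have hφ0 (q : ℚ) (x : Y) : φ q x = 0 ↔ ¬ T x ⊆ Ioi (q : ℝ) := by
    have := Set.ext_iff.1 (hφ q) x
    simpa using this.symm
  obtain ⟨e, he⟩ := exists_surjective_nat (ℚ × ℕ)
  refine ⟨fun n => ⟨fun x => min ((e n).1 : ℝ) ((e n).2 * φ (e n).1 x - 1), by fun_prop⟩, ?_, ?_⟩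
  · intro n x y hy
    by_cases h : T x ⊆ Ioi ((e n).1 : ℝ)
    · exact (min_le_left _ _).trans (h hy).le
    · refine (min_le_right _ _).trans ?_
      rw [(hφ0 _ x).2 h]
      simpa using hb x hy
  · intro x c hc
    obtain ⟨m, hm, hmin⟩ := (hcpt x).exists_isLeast (hne x)
    obtain ⟨q, hcq, hqm⟩ := exists_rat_btwn (mem_Ioi.1 (hc hm))
    have hpos : 0 < φ q x := by
      refine lt_of_le_of_ne (hφ01 q x).1 (Ne.symm ?_)
      rw [Ne, hφ0, not_not]
      exact fun y hy => hqm.trans_le (hmin hy)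
    obtain ⟨k, hk⟩ := exists_nat_gt ((c + 1) / φ q x)
    obtain ⟨n, hn⟩ := he (q, k)
    refine ⟨n, ?_⟩
    rw [div_lt_iff₀ hpos] at hk
    simp only [hn, ContinuousMap.coe_mk, lt_min_iff]
    exact ⟨hcq, by linarith⟩

theorem SetValuedUsc.neg {Y : Type*} [TopologicalSpace Y] {T : Y → Set ℝ} (hT : SetValuedUsc T) :
    SetValuedUsc fun x => Neg.neg ⁻¹' T x := by
  intro x V hV hx
  obtain ⟨U, hU, hxU, h⟩ := hT x (Neg.neg ⁻¹' V) (hV.preimage continuous_neg)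
    fun y hy => hx (by simpa using hy)
  refine ⟨U, hU, hxU, fun z hz y hy => ?_⟩
  simpa using h z hz hy

theorem SetValuedUsc.isClosed_domain {Y : Type*} [TopologicalSpace Y] {T : Y → Set ℝ}
    (hT : SetValuedUsc T) : IsClosed {x | (T x).Nonempty} := by
  refine ⟨isOpen_iff_forall_mem_open.2 fun x hx => ?_⟩
  obtain ⟨U, hU, hxU, h⟩ := hT x ∅ isOpen_empty (not_nonempty_iff_eq_empty.1 hx).subset
  exact ⟨U, fun z hz => not_nonempty_iff_eq_empty.2 (subset_empty_iff.1 (h z hz)), hU, hxU⟩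

theorem SetValuedUsc.comp_continuous {Y Z : Type*} [TopologicalSpace Y] [TopologicalSpace Z]
    {T : Y → Set ℝ} (hT : SetValuedUsc T) {g : Z → Y} (hg : Continuous g) :
    SetValuedUsc fun z => T (g z) := by
  intro x V hV hx
  obtain ⟨U, hU, hxU, h⟩ := hT (g x) V hV hx
  exact ⟨g ⁻¹' U, hU.preimage hg, hxU, fun z hz => h _ hz⟩

/-- Given pairs of bounds `(f n, g n)`, the nested pairs of bounds `(F n, G n)` obtained by
successively clamping them into the previous pair, starting from `(0, 1)`. -/
noncomputable def nestedBounds {X : Type*} [TopologicalSpace X] (f g : ℕ → C(X, ℝ)) :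
    ℕ → C(X, ℝ) × C(X, ℝ)
  | 0 => (0, 1)
  | n + 1 =>
    let P := nestedBounds f g n
    (P.1 ⊔ (P.2 ⊓ (f n ⊓ g n)), P.1 ⊔ (P.2 ⊓ (f n ⊔ g n)))

section nestedBounds

variable {X : Type*} [TopologicalSpace X] (f g : ℕ → C(X, ℝ))

theorem nestedBounds_fst_le_snd (n : ℕ) : (nestedBounds f g n).1 ≤ (nestedBounds f g n).2 := by
  cases n with
  | zero => exact fun x => zero_le_one
  | succ n => exact sup_le_sup_left (inf_le_inf_left _ inf_le_sup) _

theorem monotone_nestedBounds_fst : Monotone fun n => (nestedBounds f g n).1 :=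
  monotone_nat_of_le_succ fun _ => le_sup_left

theorem antitone_nestedBounds_snd : Antitone fun n => (nestedBounds f g n).2 :=
  antitone_nat_of_succ_le fun n => sup_le (nestedBounds_fst_le_snd f g n) inf_le_left

theorem nestedBounds_fst_mem_Icc (n : ℕ) (x : X) : (nestedBounds f g n).1 x ∈ Icc (0 : ℝ) 1 :=
  ⟨monotone_nestedBounds_fst f g n.zero_le x,
    (nestedBounds_fst_le_snd f g n x).trans (antitone_nestedBounds_snd f g n.zero_le x)⟩

theorem nestedBounds_bounds {x : X} {y : ℝ} (hy : y ∈ Icc (0 : ℝ) 1)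
    (hf : ∀ n, f n x ≤ y) (hg : ∀ n, y ≤ g n x) (n : ℕ) :
    (nestedBounds f g n).1 x ≤ y ∧ y ≤ (nestedBounds f g n).2 x := by
  induction n with
  | zero => exact hy
  | succ n ih =>
    have h1 := hf n
    have h2 := hg n
    simp only [nestedBounds, ContinuousMap.sup_apply, ContinuousMap.inf_apply]
    grind

theorem nestedBounds_succ {x : X} {y : ℝ} (hy : y ∈ Icc (0 : ℝ) 1)
    (hf : ∀ n, f n x ≤ y) (hg : ∀ n, y ≤ g n x) (n : ℕ) :
    f n x ≤ (nestedBounds f g (n + 1)).1 x ∧ (nestedBounds f g (n + 1)).2 x ≤ g n x := by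
  have h1 := hf n
  have h2 := hg n
  have h3 := nestedBounds_bounds f g hy hf hg n
  simp only [nestedBounds, ContinuousMap.sup_apply, ContinuousMap.inf_apply]
  grind

end nestedBounds

theorem exists_nested_continuous_bounds {X : Type*} [TopologicalSpace X] [NormalSpace X]
    {T : X → Set ℝ} (husc : SetValuedUsc T) (hsub : ∀ x, T x ⊆ Icc (0 : ℝ) 1)
    (hcl : ∀ x, IsClosed (T x)) (hconv : ∀ x, Convex ℝ (T x))
    [PerfectlyNormalSpace {x // (T x).Nonempty}] :
    ∃ F G : ℕ → C(X, ℝ), Monotone F ∧ Antitone G ∧ (∀ n, F n ≤ G n) ∧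
      (∀ n x, F n x ∈ Icc (0 : ℝ) 1) ∧
      ∀ x, (T x).Nonempty → ∀ y, (∀ n, F n x ≤ y ∧ y ≤ G n x) → y ∈ T x := by
  have hcpt (x : X) : IsCompact (T x) := isCompact_Icc.of_isClosed_subset (hcl x) (hsub x)
  have hD : IsClosed {x | (T x).Nonempty} := husc.isClosed_domain
  have huscD : SetValuedUsc fun x : {x // (T x).Nonempty} => T x :=
    husc.comp_continuous continuous_subtype_val
  obtain ⟨f₀, hf₀, hf₀'⟩ := exists_seq_continuous_lower_support huscD (fun x => hcpt x)
    (fun x => x.2) fun x y hy => (by norm_num : (-1 : ℝ) ≤ 0).trans (hsub _ hy).1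
  obtain ⟨g₀, hg₀, hg₀'⟩ := exists_seq_continuous_lower_support huscD.neg
    (fun x => (Homeomorph.neg ℝ).isCompact_preimage.2 (hcpt x))
    (fun x => x.2.preimage neg_surjective) fun x y hy => by
      have := (hsub _ hy).2
      simp only [mem_Ici]
      linarith
  choose f hf using fun n => ContinuousMap.exists_restrict_eq (s := {x | (T x).Nonempty}) hD (f₀ n)
  choose g hg using fun n =>
    ContinuousMap.exists_restrict_eq (s := {x | (T x).Nonempty}) hD (-g₀ n)
  have hf_eq (n : ℕ) (x : {x // (T x).Nonempty}) : f n x = f₀ n x := DFunLike.congr_fun (hf n) x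
  have hg_eq (n : ℕ) (x : {x // (T x).Nonempty}) : g n x = -g₀ n x := DFunLike.congr_fun (hg n) x
  refine ⟨fun n => (nestedBounds f g n).1, fun n => (nestedBounds f g n).2,
    monotone_nestedBounds_fst f g, antitone_nestedBounds_snd f g, nestedBounds_fst_le_snd f g,
    nestedBounds_fst_mem_Icc f g, fun x hx y hy => ?_⟩
  have hfT (n : ℕ) (z : ℝ) (hz : z ∈ T x) : f n x ≤ z := by
    rw [hf_eq n ⟨x, hx⟩]
    exact hf₀ n ⟨x, hx⟩ z hz
  have hgT (n : ℕ) (z : ℝ) (hz : z ∈ T x) : z ≤ g n x := by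
    rw [hg_eq n ⟨x, hx⟩]
    have := hg₀ n ⟨x, hx⟩ (-z) (by simpa using hz)
    linarith
  obtain ⟨w, hw⟩ := hx
  have hsucc := nestedBounds_succ f g (hsub x hw) (fun n => hfT n w hw) (fun n => hgT n w hw)
  by_contra hyT
  have hsplit : T x ⊆ Ioi y ∨ T x ⊆ Iio y := by
    by_contra! h
    obtain ⟨⟨a, ha, hay⟩, ⟨b, hb, hby⟩⟩ := And.intro (not_subset.1 h.1) (not_subset.1 h.2)
    exact hyT ((hconv x).ordConnected.out ha hb ⟨not_lt.1 hay, not_lt.1 hby⟩)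
  rcases hsplit with h | h
  · obtain ⟨n, hn⟩ := hf₀' ⟨x, w, hw⟩ y h
    rw [← hf_eq] at hn
    exact absurd (hy (n + 1)).1 (not_le.2 (hn.trans_le (hsucc n).1))
  · obtain ⟨n, hn⟩ := hg₀' ⟨x, w, hw⟩ (-y) fun z hz => by
      have : -z < y := h hz
      simp only [mem_Ioi]
      linarith
    have h1 := hg_eq n ⟨x, w, hw⟩
    have h2 := (hsucc n).2
    have h3 := (hy (n + 1)).2
    dsimp only at h1
    linarith

open Metric MeasureTheory
open scoped NNReal

section Brouwer

theorem det_one_add_eq_sum_lagrange {E : Type*} [AddCommGroup E] [Module ℝ E]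
    [FiniteDimensional ℝ E] {s : Finset ℝ} (hs : Module.finrank ℝ E < s.card) (A : E →ₗ[ℝ] E) :
    LinearMap.det (1 + A : E →ₗ[ℝ] E) =
      ∑ t ∈ s, (Lagrange.basis s id t).eval 1 * LinearMap.det (1 + t • A : E →ₗ[ℝ] E) := by
  set M := LinearMap.toMatrix (Module.finBasis ℝ E) (Module.finBasis ℝ E) A with hM
  let P : Polynomial ℝ := Matrix.det
    ((Polynomial.X : Polynomial ℝ) • M.map Polynomial.C +
      (1 : Matrix _ _ ℝ).map Polynomial.C)
  have hP (t : ℝ) : P.eval t = LinearMap.det (1 + t • A : E →ₗ[ℝ] E) := by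
    rw [← LinearMap.det_toMatrix (Module.finBasis ℝ E), ← Polynomial.coe_evalRingHom,
      RingHom.map_det]
    congr 1
    ext i j
    simp [hM, Matrix.one_apply, LinearMap.toMatrix_one]
    split_ifs <;> simp <;> ring
  have hdeg : P.degree < s.card := by
    refine Polynomial.degree_le_natDegree.trans_lt ?_
    have := Polynomial.natDegree_det_X_add_C_le M 1
    rw [Fintype.card_fin] at this
    exact_mod_cast this.trans_lt hs
  have h := congr_arg (Polynomial.eval 1) (Lagrange.eq_interpolate (v := id) Function.injective_id.injOn hdeg)
  simp only [hP, one_smul, Lagrange.interpolate_apply, Polynomial.eval_finsetSum,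
    Polynomial.eval_mul, Polynomial.eval_C, id] at h
  rw [h]
  exact Finset.sum_congr rfl fun t _ => mul_comm _ _

theorem ContinuousLinearMap.det_one_add_pos {E : Type*} [NormedAddCommGroup E] [NormedSpace ℝ E]
    {A : E →L[ℝ] E} (hA : ‖A‖ < 1) [FiniteDimensional ℝ E] : 0 < (1 + A).det := by
  have hcont : Continuous fun t : ℝ => (1 + t • A).det :=
    ContinuousLinearMap.continuous_det.comp (by fun_prop)
  have hne (t : ℝ) (ht : t ∈ Icc (0 : ℝ) 1) : (1 + t • A).det ≠ 0 := by
    have hnorm : ‖-(t • A)‖ < 1 := by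
      rw [norm_neg, norm_smul, Real.norm_of_nonneg ht.1]
      exact (mul_le_of_le_one_left (norm_nonneg _) ht.2).trans_lt hA
    have hu := isUnit_one_sub_of_norm_lt_one hnorm
    rw [sub_neg_eq_add] at hu
    exact ((hu.map (ContinuousLinearMap.toLinearMapRingHom (R₁ := ℝ) (M₁ := E))).map
      LinearMap.det).ne_zero
  by_contra! h
  obtain ⟨t, ht, ht0⟩ := intermediate_value_Icc' zero_le_one hcont.continuousOn
    (show (0 : ℝ) ∈ Icc _ _ from ⟨by simpa using h, by simp [ContinuousLinearMap.det]⟩)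
  exact hne t ht ht0

theorem LipschitzOnWith.lipschitzWith_indicator {E F : Type*} [NormedAddCommGroup E]
    [NormedSpace ℝ E] [NormedAddCommGroup F] {s : Set E} {g : E → F} {K : ℝ≥0}
    (hs : IsClosed s) (hg : LipschitzOnWith K g s) (h0 : ∀ x ∈ frontier s, g x = 0) :
    LipschitzWith K (s.indicator g) := by
  have key {x y : E} (hx : x ∈ s) (hy : y ∉ s) :
      dist (s.indicator g x) (s.indicator g y) ≤ K * dist x y := by
    obtain ⟨z, hz, hzs⟩ : ∃ z ∈ segment ℝ x y, z ∈ frontier s := by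
      by_contra! h
      have hcover (z : E) (hz : z ∈ segment ℝ x y) (hzs : z ∈ s) : z ∈ interior s := by
        by_contra hzi
        exact h z hz ⟨subset_closure hzs, hzi⟩
      have := (convex_segment x y).isPreconnected.subset_left_of_subset_union isOpen_interior
        hs.isOpen_compl (disjoint_compl_right.mono_left interior_subset)
        (fun z hz => (em (z ∈ s)).imp (hcover z hz) id)
        ⟨x, left_mem_segment ℝ x y, hcover x (left_mem_segment ℝ x y) hx⟩
      exact hy (interior_subset (this (right_mem_segment ℝ x y)))
    rw [indicator_of_mem hx, indicator_of_notMem hy, ← h0 z hzs]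
    refine (hg.dist_le_mul x hx z (hs.frontier_subset hzs)).trans ?_
    gcongr
    linarith [dist_add_dist_of_mem_segment hz, dist_nonneg (x := z) (y := y)]
  refine LipschitzWith.of_dist_le_mul fun x y => ?_
  by_cases hx : x ∈ s <;> by_cases hy : y ∈ s
  · rw [indicator_of_mem hx, indicator_of_mem hy]
    exact hg.dist_le_mul x hx y hy
  · exact key hx hy
  · rw [dist_comm, dist_comm x]
    exact key hy hx
  · rw [indicator_of_notMem hx, indicator_of_notMem hy, dist_self]
    positivity

variable {E : Type*} [NormedAddCommGroup E] [NormedSpace ℝ E]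

theorem bijOn_ball_add_smul {g : E → E} {K : ℝ≥0} [CompleteSpace E]
    (hg : LipschitzOnWith K g (closedBall 0 1)) (h0 : ∀ x ∈ sphere (0 : E) 1, g x = 0)
    (h1 : ∀ x ∈ closedBall (0 : E) 1, ‖x + g x‖ ≤ 1) {t : ℝ} (ht0 : 0 ≤ t) (ht1 : t < 1)
    (htK : t * K < 1) : BijOn (fun x => x + t • g x) (ball 0 1) (ball 0 1) := by
  lift t to ℝ≥0 using ht0
  rcases subsingleton_or_nontrivial E with hE | hE
  · refine ⟨fun x hx => ?_, injOn_of_subsingleton _ _, fun x hx => ⟨x, hx, Subsingleton.elim _ _⟩⟩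
    rwa [Subsingleton.elim ((fun x => x + (t : ℝ) • g x) x) x]
  have hĝ : LipschitzWith K ((closedBall (0 : E) 1).indicator g) :=
    hg.lipschitzWith_indicator isClosed_closedBall fun x hx =>
      h0 x (frontier_closedBall_subset_sphere hx)
  set ĝ := (closedBall (0 : E) 1).indicator g
  have happ : ApproximatesLinearOn (fun x => x + (t : ℝ) • ĝ x)
      ((ContinuousLinearEquiv.refl ℝ E : E ≃L[ℝ] E) : E →L[ℝ] E) univ (t * K) := by
    intro x _ y _
    have : x + (t : ℝ) • ĝ x - (y + (t : ℝ) • ĝ y) -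
        ((ContinuousLinearEquiv.refl ℝ E : E ≃L[ℝ] E) : E →L[ℝ] E) (x - y) =
        (t : ℝ) • (ĝ x - ĝ y) := by
      simp [smul_sub]
      abel
    rw [this, norm_smul, Real.norm_of_nonneg t.coe_nonneg, NNReal.coe_mul, mul_assoc]
    gcongr
    simpa [dist_eq_norm] using hĝ.dist_le_mul x y
  have hc : Subsingleton E ∨
      t * K < ‖((ContinuousLinearEquiv.refl ℝ E).symm : E →L[ℝ] E)‖₊⁻¹ := by
    right
    have : ‖((ContinuousLinearEquiv.refl ℝ E).symm : E →L[ℝ] E)‖₊ = 1 :=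
      NNReal.eq ContinuousLinearMap.norm_id
    rw [this, inv_one]
    exact_mod_cast htK
  have heq (x : E) (hx : x ∈ closedBall (0 : E) 1) : ĝ x = g x := indicator_of_mem hx g
  refine ⟨fun x hx => ?_, fun x hx y hy hxy => ?_, fun y hy => ?_⟩
  · have hx' := ball_subset_closedBall hx
    rw [mem_ball_zero_iff] at hx ⊢
    have : x + (t : ℝ) • g x = (1 - (t : ℝ)) • x + (t : ℝ) • (x + g x) := by
      module
    dsimp only
    rw [this]
    refine (norm_add_le _ _).trans_lt ?_
    rw [norm_smul, norm_smul, Real.norm_of_nonneg t.coe_nonneg, Real.norm_of_nonneg (by linarith)]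
    nlinarith [h1 x hx', t.2]
  · refine happ.injOn hc (mem_univ x) (mem_univ y) ?_
    dsimp only at hxy ⊢
    rwa [heq x (ball_subset_closedBall hx), heq y (ball_subset_closedBall hy)]
  · obtain ⟨x, hx⟩ := happ.surjective hc y
    dsimp only at hx
    rw [mem_ball_zero_iff] at hy
    have hx1 : ‖x‖ < 1 := by
      by_contra! h
      have hx0 : ĝ x = 0 := by
        rcases h.eq_or_lt with h | h
        · rw [heq x (by simp [h])]
          exact h0 x (by simp [h])
        · exact indicator_of_notMem (by simpa using h) g
      rw [hx0, smul_zero, add_zero] at hx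
      rw [hx] at h
      exact absurd hy (not_lt.2 h)
    refine ⟨x, by simpa using hx1, ?_⟩
    dsimp only
    rwa [← heq x (by simpa using hx1.le)]


theorem setIntegral_ball_det_one_add_smul_fderiv [FiniteDimensional ℝ E] [MeasurableSpace E]
    [BorelSpace E] (μ : Measure E) [μ.IsAddHaarMeasure]
    {g : E → E} {K : ℝ≥0} (hdiff : ∀ x ∈ closedBall (0 : E) 1, DifferentiableAt ℝ g x)
    (hK : ∀ x ∈ closedBall (0 : E) 1, ‖fderiv ℝ g x‖ ≤ K) (h0 : ∀ x ∈ sphere (0 : E) 1, g x = 0)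
    (h1 : ∀ x ∈ closedBall (0 : E) 1, ‖x + g x‖ ≤ 1) {t : ℝ} (ht0 : 0 ≤ t) (ht1 : t < 1)
    (htK : t * K < 1) :
    ∫ x in ball (0 : E) 1, (1 + t • fderiv ℝ g x).det ∂μ = μ.real (ball (0 : E) 1) := by
  have hlip : LipschitzOnWith K g (closedBall 0 1) :=
    (convex_closedBall (0 : E) 1).lipschitzOnWith_of_nnnorm_fderiv_le hdiff hK
  have hbij := bijOn_ball_add_smul hlip h0 h1 ht0 ht1 htK
  have hderiv (x : E) (hx : x ∈ ball (0 : E) 1) :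
      HasFDerivWithinAt (fun x => x + t • g x) (1 + t • fderiv ℝ g x) (ball 0 1) x :=
    ((hasFDerivAt_id x).add
      ((hdiff x (ball_subset_closedBall hx)).hasFDerivAt.const_smul t)).hasFDerivWithinAt
  have hpos (x : E) (hx : x ∈ ball (0 : E) 1) : 0 < (1 + t • fderiv ℝ g x).det := by
    refine ContinuousLinearMap.det_one_add_pos (lt_of_le_of_lt ?_ htK)
    rw [norm_smul, Real.norm_of_nonneg ht0]
    gcongr
    exact hK x (ball_subset_closedBall hx)
  have h := integral_image_eq_integral_abs_det_fderiv_smul μ measurableSet_ball hderiv hbij.injOn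
    fun _ => (1 : ℝ)
  rw [hbij.image_eq] at h
  simp only [integral_const, MeasurableSet.univ, measureReal_restrict_apply, univ_inter, smul_eq_mul,
    mul_one] at h
  rw [h]
  exact setIntegral_congr_fun measurableSet_ball fun x hx => (abs_of_pos (hpos x hx)).symm

theorem not_retraction_closedBall {E : Type*} [NormedAddCommGroup E] [InnerProductSpace ℝ E]
    [FiniteDimensional ℝ E] {r : E → E} (hr : ∀ x ∈ closedBall (0 : E) 1, ContDiffAt ℝ 1 r x)
    (hr1 : ∀ x ∈ closedBall (0 : E) 1, ‖r x‖ = 1) (hrid : ∀ x ∈ sphere (0 : E) 1, r x = x) :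
    False := by
  borelize E
  set g : E → E := fun x => r x - x with hg
  have hgC (x : E) (hx : x ∈ closedBall (0 : E) 1) : ContDiffAt ℝ 1 g x :=
    (hr x hx).sub contDiffAt_id
  have hgd (x : E) (hx : x ∈ closedBall (0 : E) 1) : DifferentiableAt ℝ g x :=
    (hgC x hx).differentiableAt one_ne_zero
  have hcont : ContinuousOn (fderiv ℝ g) (closedBall 0 1) := fun x hx =>
    ((hgC x hx).fderiv_right (m := 0) (by norm_num)).continuousAt.continuousWithinAt
  obtain ⟨C, hC⟩ := (isCompact_closedBall (0 : E) 1).exists_bound_of_continuousOn hcont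
  lift C to ℝ≥0 using (norm_nonneg _).trans (hC 0 (by simp))
  have hε : (0 : ℝ) < 1 / (C + 1) := by positivity
  obtain ⟨s, hs, hcard⟩ := (Ioo_infinite hε).exists_subset_card_eq (Module.finrank ℝ E + 1)
  have hint (t : ℝ) : IntegrableOn (fun x => (1 + t • fderiv ℝ g x).det) (ball (0 : E) 1) := by
    refine IntegrableOn.mono_set ?_ ball_subset_closedBall
    refine ContinuousOn.integrableOn_compact (isCompact_closedBall _ _) ?_
    exact ContinuousLinearMap.continuous_det.comp_continuousOn
      (continuousOn_const.add (hcont.const_smul t))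
  have hvol (t : ℝ) (ht : t ∈ s) :
      ∫ x in ball (0 : E) 1, (1 + t • fderiv ℝ g x).det = volume.real (ball (0 : E) 1) := by
    obtain ⟨ht0, ht1⟩ := hs ht
    rw [lt_div_iff₀ (by positivity)] at ht1
    refine setIntegral_ball_det_one_add_smul_fderiv volume hgd hC (fun x hx => ?_) (fun x hx => ?_)
      ht0.le ?_ ?_
    · simp [hg, hrid x hx]
    · simp [hg, hr1 x hx]
    · nlinarith [mul_nonneg ht0.le C.coe_nonneg]
    · nlinarith
  have hzero (x : E) (hx : x ∈ ball (0 : E) 1) : (1 + fderiv ℝ g x).det = 0 := by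
    have hx' := ball_subset_closedBall hx
    have hrd : HasFDerivAt r (1 + fderiv ℝ g x) x := by
      convert! (hasFDerivAt_id x).add (hgd x hx').hasFDerivAt using 1
      ext y
      simp [hg]
    have horth : 2 • (innerSL ℝ (r x)).comp (1 + fderiv ℝ g x) = 0 := by
      refine hrd.norm_sq.unique ((hasFDerivAt_const (1 : ℝ) x).congr_of_eventuallyEq ?_)
      filter_upwards [isOpen_ball.mem_nhds hx] with y hy
      simp [hr1 y (ball_subset_closedBall hy)]
    by_contra hdet
    obtain ⟨v, hv⟩ := (LinearMap.equivOfDetNeZero _ hdet).surjective (r x)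
    have h2 : (1 + fderiv ℝ g x) v = r x := hv
    have h3 : 2 • inner ℝ (r x) ((1 + fderiv ℝ g x) v) = 0 := DFunLike.congr_fun horth v
    rw [h2, real_inner_self_eq_norm_sq, hr1 x hx'] at h3
    norm_num at h3
  have hsum (x : E) : (1 + fderiv ℝ g x).det =
      ∑ t ∈ s, (Lagrange.basis s id t).eval 1 * (1 + t • fderiv ℝ g x).det :=
    det_one_add_eq_sum_lagrange (by omega) (fderiv ℝ g x : E →ₗ[ℝ] E)
  have hbasis : ∑ t ∈ s, (Lagrange.basis s id t).eval 1 = (1 : ℝ) := by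
    rw [← Polynomial.eval_finsetSum, Lagrange.sum_basis Function.injective_id.injOn
      (Finset.card_pos.1 (by omega)), Polynomial.eval_one]
  have hfin : ∫ x in ball (0 : E) 1, (1 + fderiv ℝ g x).det = volume.real (ball (0 : E) 1) := by
    simp_rw [hsum]
    rw [integral_finsetSum _ fun t _ => (hint t).const_mul _]
    simp_rw [integral_const_mul]
    rw [Finset.sum_congr rfl fun t ht => by rw [hvol t ht], ← Finset.sum_mul, hbasis, one_mul]
  rw [setIntegral_congr_fun measurableSet_ball hzero, integral_zero] at hfin
  exact (measure_ball_pos volume (0 : E) one_pos).ne'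
    ((measureReal_eq_zero_iff measure_ball_lt_top.ne).1 hfin.symm)

/-- A smooth self-map `p` of the closed unit ball has a fixed point: otherwise the intersection
of the sphere with the ray from `p x` through `x` gives a smooth retraction to the sphere. -/
theorem exists_fixedPoint_closedBall_of_contDiff {E : Type*} [NormedAddCommGroup E]
    [InnerProductSpace ℝ E] [FiniteDimensional ℝ E] {p : E → E} (hp : ContDiff ℝ 1 p)
    (hp1 : ∀ x ∈ closedBall (0 : E) 1, ‖p x‖ ≤ 1) : ∃ x ∈ closedBall (0 : E) 1, p x = x := by
  by_contra! hne
  let u : E → E := fun x => x - p x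
  let b : E → ℝ := fun x => inner ℝ x (u x)
  let Δ : E → ℝ := fun x => b x ^ 2 + ‖u x‖ ^ 2 * (1 - ‖x‖ ^ 2)
  let l : E → ℝ := fun x => (-b x + √(Δ x)) / ‖u x‖ ^ 2
  have hu : ContDiff ℝ 1 u := contDiff_id.sub hp
  have hb : ContDiff ℝ 1 b := contDiff_id.inner ℝ hu
  have hΔ : ContDiff ℝ 1 Δ :=
    (hb.pow 2).add ((hu.norm_sq ℝ).mul (contDiff_const.sub (contDiff_id.norm_sq ℝ)))
  have hu0 (x : E) (hx : x ∈ closedBall (0 : E) 1) : 0 < ‖u x‖ ^ 2 := by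
    have : u x ≠ 0 := fun h => hne x hx (sub_eq_zero.1 h).symm
    positivity
  have hb0 (x : E) (hx : ‖x‖ = 1) : 0 < b x := by
    have hx' : x ∈ closedBall (0 : E) 1 := by simp [hx]
    have h1 : inner ℝ x (p x) ≤ 1 := by
      have := real_inner_le_norm x (p x)
      rw [hx, one_mul] at this
      exact this.trans (hp1 x hx')
    have h2 : ‖u x‖ ^ 2 = ‖x‖ ^ 2 - 2 * inner ℝ x (p x) + ‖p x‖ ^ 2 := norm_sub_sq_real x (p x)
    have h3 : b x = ‖x‖ ^ 2 - inner ℝ x (p x) := by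
      simp [b, u, inner_sub_right]
    have := hu0 x hx'
    have := hp1 x hx'
    rw [hx] at h2 h3
    nlinarith [norm_nonneg (p x)]
  have hΔ0 (x : E) (hx : x ∈ closedBall (0 : E) 1) : 0 < Δ x := by
    have hx1 : ‖x‖ ≤ 1 := by simpa using hx
    rcases hx1.eq_or_lt with h | h
    · have := hb0 x h
      simp only [Δ, h]
      norm_num
      positivity
    · have := hu0 x hx
      have : 0 < 1 - ‖x‖ ^ 2 := by nlinarith [norm_nonneg x]
      positivity
  refine not_retraction_closedBall (r := fun x => x + l x • u x) (fun x hx => ?_) (fun x hx => ?_)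
    fun x hx => ?_
  · exact contDiffAt_id.add (((hb.contDiffAt.neg.add (hΔ.contDiffAt.sqrt (hΔ0 x hx).ne')).div
      (hu.norm_sq ℝ).contDiffAt (hu0 x hx).ne').smul hu.contDiffAt)
  · have hsq : ‖x + l x • u x‖ ^ 2 = 1 := by
      rw [norm_add_sq_real, inner_smul_right, norm_smul, mul_pow, Real.norm_eq_abs, sq_abs]
      change ‖x‖ ^ 2 + 2 * (l x * b x) + l x ^ 2 * ‖u x‖ ^ 2 = 1
      have hl : l x * ‖u x‖ ^ 2 = -b x + √(Δ x) := div_mul_cancel₀ _ (hu0 x hx).ne'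
      have h2 : √(Δ x) ^ 2 = b x ^ 2 + ‖u x‖ ^ 2 * (1 - ‖x‖ ^ 2) := Real.sq_sqrt (hΔ0 x hx).le
      rw [show √(Δ x) = l x * ‖u x‖ ^ 2 + b x by linarith] at h2
      have := (hu0 x hx).ne'
      refine mul_left_cancel₀ this ?_
      linear_combination h2
    exact (pow_eq_one_iff_of_nonneg (norm_nonneg _) two_ne_zero).1 hsq
  · have hx1 : ‖x‖ = 1 := by simpa using hx
    have : l x = 0 := by
      simp [l, Δ, hx1, Real.sqrt_sq (hb0 x hx1).le]
    simp [this]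

theorem exists_fixedPoint_of_norm_le_one {E : Type*} [NormedAddCommGroup E]
    [InnerProductSpace ℝ E] [FiniteDimensional ℝ E] {f : E → E} (hf : Continuous f)
    (hf1 : ∀ x, ‖f x‖ ≤ 1) : ∃ x, f x = x := by
  by_contra! hne
  obtain ⟨x₀, -, hmin⟩ := (isCompact_closedBall (0 : E) 1).exists_isMinOn ⟨0, by simp⟩
    (hf.dist continuous_id).continuousOn
  set δ := dist (f x₀) x₀ with hδ
  have hδ0 : 0 < δ := dist_pos.2 (hne x₀)
  obtain ⟨p, hp, hpf, -⟩ := hf.exists_contDiff_approx 1 (ε := fun _ => δ / 2) continuous_const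
    fun _ => half_pos hδ0
  have hpn (x : E) : ‖p x‖ ≤ 1 + δ / 2 := by
    have h1 := hpf x
    rw [dist_eq_norm] at h1
    have h2 := norm_le_norm_add_norm_sub (f x) (p x)
    rw [norm_sub_rev] at h2
    linarith [hf1 x]
  have hc : 0 < 1 + δ / 2 := by positivity
  obtain ⟨x, hx, hpx⟩ := exists_fixedPoint_closedBall_of_contDiff
    (p := fun x => (1 + δ / 2)⁻¹ • p x) (hp.const_smul _) fun x _ => by
      rw [norm_smul, norm_inv, Real.norm_of_nonneg hc.le, inv_mul_le_one₀ hc]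
      exact hpn x
  have hpx' : p x = (1 + δ / 2) • x := by
    rw [← smul_inv_smul₀ hc.ne' (p x), hpx]
  have h1 : dist (p x) x ≤ δ / 2 := by
    rw [dist_eq_norm, hpx', add_smul, one_smul, add_sub_cancel_left, norm_smul,
      Real.norm_of_nonneg (half_pos hδ0).le]
    exact mul_le_of_le_one_right (half_pos hδ0).le (by simpa using hx)
  have h2 : δ ≤ dist (f x) x := hmin hx
  have h3 := hpf x
  have := dist_triangle (f x) (p x) x
  rw [dist_comm] at h3
  linarith

/-- The **Brouwer fixed point theorem** for the cube. -/
theorem exists_fixedPoint_unitCube {ι : Type*} [Finite ι]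
    {f : (ι → Icc (0 : ℝ) 1) → ι → Icc (0 : ℝ) 1} (hf : Continuous f) : ∃ x, f x = x := by
  cases nonempty_fintype ι
  let R : ℝ := √(Fintype.card ι) + 1
  have hR : 0 < R := by positivity
  let c : EuclideanSpace ℝ ι → ι → Icc (0 : ℝ) 1 := fun x i => projIcc 0 1 zero_le_one (R * x i)
  have hc : Continuous c := by
    refine continuous_pi fun i => continuous_projIcc.comp ?_
    fun_prop
  let h : EuclideanSpace ℝ ι → EuclideanSpace ℝ ι :=
    fun x => WithLp.toLp 2 fun i => R⁻¹ * (f (c x) i : ℝ)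
  have hh : Continuous h := by
    refine (PiLp.continuous_toLp 2 _).comp (continuous_pi fun i => ?_)
    have : Continuous fun x => f (c x) i := (continuous_apply i).comp (hf.comp hc)
    fun_prop
  obtain ⟨x, hx⟩ := exists_fixedPoint_of_norm_le_one hh fun x => by
    rw [EuclideanSpace.norm_eq, Real.sqrt_le_iff, one_pow]
    refine ⟨zero_le_one, ?_⟩
    have hi (i : ι) : ‖h x i‖ ^ 2 ≤ (R⁻¹) ^ 2 := by
      have h01 := (f (c x) i).2
      have : ‖h x i‖ = R⁻¹ * (f (c x) i : ℝ) := by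
        rw [Real.norm_of_nonneg]
        have := h01.1
        simp only [h]
        positivity
      rw [this]
      gcongr
      · exact mul_nonneg (by positivity) h01.1
      · exact mul_le_of_le_one_right (by positivity) h01.2
    refine (Finset.sum_le_sum fun i _ => hi i).trans ?_
    rw [Finset.sum_const, Finset.card_univ, nsmul_eq_mul, inv_pow, ← div_eq_mul_inv,
      div_le_one (by positivity)]
    have := Real.sq_sqrt (Nat.cast_nonneg (α := ℝ) (Fintype.card ι))
    nlinarith [Real.sqrt_nonneg (Fintype.card ι : ℝ)]
  have hcx : f (c x) = c x := by
    ext i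
    have h1 : R * x i = f (c x) i := by
      rw [← hx]
      simp only [h, hx]
      rw [mul_inv_cancel_left₀ hR.ne']
    simp only [c] at h1 ⊢
    rw [h1, projIcc_val]
  exact ⟨c x, hcx⟩

end Brouwer

theorem exists_forall_mem_eq_continuousMap {I : Type*} (S : Finset I)
    (H : I → C(I → Icc (0 : ℝ) 1, ℝ)) (hH : ∀ α x, H α x ∈ Icc (0 : ℝ) 1) :
    ∃ x : I → Icc (0 : ℝ) 1, ∀ α ∈ S, (x α : ℝ) = H α x := by
  classical
  let e : (S → Icc (0 : ℝ) 1) → I → Icc (0 : ℝ) 1 :=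
    fun y α => if h : α ∈ S then y ⟨α, h⟩ else 0
  have he : Continuous e := by
    refine continuous_pi fun α => ?_
    by_cases h : α ∈ S
    · simpa [e, h] using continuous_apply _
    · simpa [e, h] using continuous_const
  obtain ⟨y, hy⟩ := exists_fixedPoint_unitCube
    (f := fun y (α : S) => (⟨H α (e y), hH α (e y)⟩ : Icc (0 : ℝ) 1))
    (continuous_pi fun α => ((H α).continuous.comp he).subtype_mk _)
  refine ⟨e y, fun α hα => ?_⟩
  have h := congr_arg Subtype.val (congr_fun hy ⟨α, hα⟩)
  simpa [e, hα] using h.symm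

/-- A Gale–Mas-Colell type fixed point theorem: for an arbitrary
family of usc set-valued maps `T α` on the product `∏ [0,1]` with (possibly empty)
closed convex values in `[0,1]`, whose domains `{x : T α x ≠ ∅}` are perfectly normal,
there is a point `x` with `x α ∈ T α x` or `T α x = ∅` for every `α`. -/
theorem gale_masColell_uncountable
    {I : Type*} (T : I → (I → Set.Icc (0 : ℝ) 1) → Set ℝ)
    (hTusc : ∀ α, SetValuedUsc (T α))
    (hTsub : ∀ α x, T α x ⊆ Set.Icc (0 : ℝ) 1)
    (hTcl : ∀ α x, IsClosed (T α x))
    (hTconv : ∀ α x, Convex ℝ (T α x))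
    (hdom : ∀ α, PerfectlyNormalSpace {x : I → Set.Icc (0 : ℝ) 1 // (T α x).Nonempty}) :
    ∃ x : I → Set.Icc (0 : ℝ) 1, ∀ α, (x α : ℝ) ∈ T α x ∨ T α x = ∅ := by
  choose F G hF hG hFG hF01 hT using fun α =>
    have := hdom α
    exists_nested_continuous_bounds (hTusc α) (hTsub α) (hTcl α) (hTconv α)
  let K : I × ℕ → Set (I → Icc (0 : ℝ) 1) :=
    fun i => {x | F i.1 i.2 x ≤ x i.1 ∧ (x i.1 : ℝ) ≤ G i.1 i.2 x}
  have hK (i : I × ℕ) : IsClosed (K i) := by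
    have hx : Continuous fun x : I → Icc (0 : ℝ) 1 => (x i.1 : ℝ) := by fun_prop
    exact (isClosed_le (F i.1 i.2).continuous hx).inter (isClosed_le hx (G i.1 i.2).continuous)
  obtain ⟨x, hx⟩ := CompactSpace.iInter_nonempty hK fun u => by
    classical
    let N := u.sup Prod.snd
    obtain ⟨x, hx⟩ := exists_forall_mem_eq_continuousMap (u.image Prod.fst) (fun α => F α N)
      fun α => hF01 α N
    refine ⟨x, mem_iInter₂.2 fun i hi => ?_⟩
    have hN : i.2 ≤ N := Finset.le_sup (f := Prod.snd) hi
    have hxi := hx i.1 (Finset.mem_image_of_mem _ hi)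
    exact ⟨(hF i.1 hN x).trans hxi.ge, hxi.le.trans ((hFG i.1 N x).trans (hG i.1 hN x))⟩
  refine ⟨x, fun α => ?_⟩
  rcases (T α x).eq_empty_or_nonempty with h | h
  · exact Or.inr h
  · exact Or.inl (hT α x h _ fun n => mem_iInter.1 hx (α, n))
end

section
/- Let I be an arbitrary index set, for each i ∈ I let X_i = [0,1], and let X = ∏_{j∈I} X_j carry the product topology. For each i ∈ I, let P_i : X → [0,1] be an upper semicontinuous set-valued map (a preference correspondence) whose values are (possibly empty) closed convex subsets of [0,1], such that Dom(P_i) = {x ∈ X : P_i(x) ≠ ∅}, with the subspace topology, is perfectly normal. If for every i ∈ I and every x ∈ X one has x_i ∉ P_i(x), then there exists y ∈ X such that P_i(y) = ∅ for every i ∈ I (an equilibrium of the qualitative game). -/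
universe u

theorem exists_commRing_sq_zero_prod_ne_zero (ι : Type u) [Fintype ι] :
    ∃ (Λ : Type u) (_ : CommRing Λ) (ε : ι → Λ),
      (2 : Λ) = 0 ∧ (∀ a, ε a * ε a = 0) ∧ ∏ a, ε a ≠ 0 := by
  classical
  let J : Ideal (MvPolynomial ι (ZMod 2)) := Ideal.span
    ((fun s => MvPolynomial.monomial s (1 : ZMod 2)) '' Set.range fun a => Finsupp.single a 2)
  refine ⟨MvPolynomial ι (ZMod 2) ⧸ J, inferInstance,
    fun a => Ideal.Quotient.mk J (MvPolynomial.X a), ?_, fun a => ?_, ?_⟩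
  · have h : (2 : MvPolynomial ι (ZMod 2)) = 0 := CharTwo.two_eq_zero
    rw [← map_ofNat (Ideal.Quotient.mk J) 2, h, map_zero]
  · rw [← map_mul, Ideal.Quotient.eq_zero_iff_mem]
    refine Ideal.subset_span ⟨_, ⟨a, rfl⟩, ?_⟩
    simp [MvPolynomial.X, MvPolynomial.monomial_mul, ← Finsupp.single_add]
  · rw [← map_prod, Ne, Ideal.Quotient.eq_zero_iff_mem, MvPolynomial.mem_ideal_span_monomial_image]
    intro h
    have hp : (∏ a, MvPolynomial.X a : MvPolynomial ι (ZMod 2)) =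
        MvPolynomial.monomial (∑ a, Finsupp.single a 1) 1 := by
      rw [MvPolynomial.monomial_sum_one]; rfl
    rw [hp] at h
    obtain ⟨_, ⟨a, rfl⟩, ha⟩ := h (∑ a, Finsupp.single a 1) (by simp [MvPolynomial.mem_support_iff])
    have := ha a
    simp [Finsupp.finsetSum_apply, Finsupp.single_apply] at this

/-- If `D * D = 0` and every `C i` commutes with `D`, then perturbing the `C i` by anticommutators
with `D` changes their product by an anticommutator with `D`. -/
theorem exists_prod_add_anticommutator_eq {R ι : Type*} [Ring R] {D : R}
    (hD : D * D = 0) (C u : ι → R) (hC : ∀ i, Commute D (C i)) (L : List ι) :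
    ∃ w, (L.map fun i => C i + (D * u i + u i * D)).prod =
      (L.map C).prod + (D * w + w * D) := by
  have hu (v : R) : Commute D (D * v + v * D) := by
    simp only [Commute, SemiconjBy, mul_add, add_mul, ← mul_assoc, hD, zero_mul, zero_add]
    rw [mul_assoc _ D D, hD, mul_zero, add_zero]
  induction L with
  | nil => exact ⟨0, by simp⟩
  | cons i L ih =>
    obtain ⟨w, hw⟩ := ih
    have hP : Commute D (L.map fun i => C i + (D * u i + u i * D)).prod := by
      refine Commute.list_prod_right _ _ fun x hx => ?_
      obtain ⟨j, -, rfl⟩ := List.mem_map.1 hx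
      exact (hC j).add_right (hu _)
    refine ⟨C i * w + u i * (L.map fun i => C i + (D * u i + u i * D)).prod, ?_⟩
    simp only [List.map_cons, List.prod_cons]
    generalize (L.map fun i => C i + (D * u i + u i * D)).prod = Q at hw hP ⊢
    have h1 : D * C i = C i * D := hC i
    have h3 : D * Q = Q * D := hP
    calc (C i + (D * u i + u i * D)) * Q = C i * Q + D * (u i * Q) + u i * (D * Q) := by
          noncomm_ring
      _ = C i * (L.map C).prod + ((C i * D) * w + C i * w * D)
            + D * (u i * Q) + u i * (Q * D) := by
          rw [h3]; nth_rw 1 [hw]; noncomm_ring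
      _ = _ := by rw [← h1]; noncomm_ring

section Lattice

/-- Multiplication by the function `u`. -/
def mulOperator {Λ G : Type*} [CommRing Λ] (u : G → Λ) : Module.End Λ (G → Λ) where
  toFun f z := u z * f z
  map_add' f g := by ext z; simp [mul_add]
  map_smul' r f := by ext z; simp [mul_left_comm]

theorem mulOperator_apply {Λ G : Type*} [CommRing Λ] (u f : G → Λ) (z : G) :
    mulOperator u f z = u z * f z := rfl

variable {Λ G ι : Type*} [CommRing Λ] [AddCommGroup G] [Fintype ι]

/-- The operator attached to the `1`-cochain `c` on the lattice spanned by the `e a`, with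
formal directions `ε a`. -/
def edgeOperator (ε : ι → Λ) (e : ι → G) (c : G → ι → Λ) : Module.End Λ (G → Λ) where
  toFun f z := ∑ a, c z a * ε a * f (z + e a)
  map_add' f g := by ext z; simp [mul_add, Finset.sum_add_distrib]
  map_smul' r f := by ext z; simp [Finset.mul_sum, mul_left_comm]

theorem edgeOperator_apply (ε : ι → Λ) (e : ι → G) (c : G → ι → Λ) (f : G → Λ) (z : G) :
    edgeOperator ε e c f z = ∑ a, c z a * ε a * f (z + e a) := rfl

theorem sum_sum_eq_zero_of_symm (h2 : (2 : Λ) = 0) (K : ι → ι → Λ) (hs : ∀ a b, K a b = K b a)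
    (h0 : ∀ a, K a a = 0) : ∑ a, ∑ b, K a b = 0 := by
  classical
  rw [← Fintype.sum_prod_type']
  refine Finset.sum_involution (fun p _ => p.swap) ?_ ?_ (by simp) (by simp)
  · rintro ⟨a, b⟩ -
    rw [Prod.swap, hs b a, ← two_mul, h2, zero_mul]
  · rintro ⟨a, b⟩ - h h'
    have hab : b = a := (Prod.mk.inj h').1
    exact h (by rw [hab, h0])

theorem commute_edgeOperator_one (h2 : (2 : Λ) = 0) {ε : ι → Λ} (hε : ∀ a, ε a * ε a = 0)
    (e : ι → G) (c : G → ι → Λ)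
    (hc : ∀ z a b, c z a + c (z + e a) b = c z b + c (z + e b) a) :
    Commute (edgeOperator ε e 1) (edgeOperator ε e c) := by
  have hneg (x : Λ) : -x = x := by linear_combination (-x) * h2
  refine LinearMap.ext fun f => funext fun z => ?_
  rw [← sub_eq_zero, sub_eq_add_neg, hneg]
  simp only [Module.End.mul_apply, edgeOperator_apply, Pi.one_apply, one_mul, Finset.mul_sum,
    ← Finset.sum_add_distrib]
  refine sum_sum_eq_zero_of_symm h2 _ (fun a b => ?_) fun a => ?_
  · rw [add_right_comm z (e b) (e a)]
    linear_combination ε a * ε b * f (z + e a + e b) * hc z a b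
  · linear_combination (c z a + c (z + e a) a) * f (z + e a + e a) * hε a

theorem edgeOperator_one_mul_self (h2 : (2 : Λ) = 0) {ε : ι → Λ} (hε : ∀ a, ε a * ε a = 0)
    (e : ι → G) : edgeOperator ε e (1 : G → ι → Λ) * edgeOperator ε e 1 = 0 := by
  refine LinearMap.ext fun f => funext fun z => ?_
  simp only [Module.End.mul_apply, edgeOperator_apply, Pi.one_apply, one_mul, Finset.mul_sum,
    LinearMap.zero_apply, Pi.zero_apply]
  refine sum_sum_eq_zero_of_symm h2 _ (fun a b => ?_) fun a => ?_
  · rw [add_right_comm z (e b) (e a)]; ring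
  · linear_combination f (z + e a + e a) * hε a

theorem edgeOperator_add_coboundary (ε : ι → Λ) (e : ι → G)
    (c : G → ι → Λ) (u : G → Λ) :
    edgeOperator ε e (fun z a => c z a + (u (z + e a) + u z)) =
      edgeOperator ε e c +
        (edgeOperator ε e 1 * mulOperator u + mulOperator u * edgeOperator ε e 1) := by
  refine LinearMap.ext fun f => funext fun z => ?_
  simp only [Module.End.mul_apply, LinearMap.add_apply, Pi.add_apply, edgeOperator_apply,
    mulOperator_apply, Pi.one_apply, Finset.mul_sum, ← Finset.sum_add_distrib]
  exact Finset.sum_congr rfl fun a _ => by ring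

theorem sum_anticommutator_edgeOperator_one [Fintype G] (h2 : (2 : Λ) = 0) (ε : ι → Λ) (e : ι → G)
    (w : Module.End Λ (G → Λ)) :
    ∑ z, (edgeOperator ε e 1 * w + w * edgeOperator ε e 1) 1 z = 0 := by
  have h1 : edgeOperator ε e 1 (1 : G → Λ) = (∑ a, ε a) • (1 : G → Λ) := by
    ext z; simp [edgeOperator_apply]
  simp only [LinearMap.add_apply, Module.End.mul_apply, h1, map_smul, Pi.add_apply,
    Finset.sum_add_distrib]
  simp only [edgeOperator_apply, Pi.one_apply, one_mul]
  rw [Finset.sum_comm]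
  have (a : ι) : ∑ z, ε a * w 1 (z + e a) = ε a * ∑ z, w 1 z := by
    rw [← Finset.mul_sum, ← Equiv.sum_comp (Equiv.addRight (e a)) (w 1)]; rfl
  simp only [this, Pi.smul_apply, smul_eq_mul, ← Finset.mul_sum, ← Finset.sum_mul]
  rw [← two_mul, h2, zero_mul]

theorem sum_prod_edgeOperator_add_coboundary [Fintype G] (h2 : (2 : Λ) = 0) {ε : ι → Λ}
    (hε : ∀ a, ε a * ε a = 0) (e : ι → G) (c : ι → G → ι → Λ)
    (hc : ∀ i z a b, c i z a + c i (z + e a) b = c i z b + c i (z + e b) a)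
    (u : ι → G → Λ) (L : List ι) :
    ∑ z, (L.map fun i => edgeOperator ε e fun z a => c i z a + (u i (z + e a) + u i z)).prod 1 z =
      ∑ z, (L.map fun i => edgeOperator ε e (c i)).prod 1 z := by
  obtain ⟨w, hw⟩ := exists_prod_add_anticommutator_eq (edgeOperator_one_mul_self h2 hε e)
    (fun i => edgeOperator ε e (c i)) (fun i => mulOperator (u i))
    (fun i => commute_edgeOperator_one h2 hε e _ (hc i)) L
  simp only [edgeOperator_add_coboundary, hw]
  rw [← add_zero (∑ z, (L.map fun i => edgeOperator ε e (c i)).prod 1 z),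
    ← sum_anticommutator_edgeOperator_one h2 ε e w, ← Finset.sum_add_distrib]
  rfl

theorem exists_ne_zero_of_prod_edgeOperator_ne_zero [DecidableEq ι] {ε : ι → Λ}
    (hε : ∀ a, ε a * ε a = 0) (e : ι → G) (c : ι → G → ι → Λ) (z : G) (L : List ι) (B : Finset ι)
    (h : (∏ b ∈ B, ε b) * (L.map fun i => edgeOperator ε e (c i)).prod 1 (z + ∑ b ∈ B, e b) ≠ 0) :
    ∀ i ∈ L, ∃ B' : Finset ι, ∃ a ∉ B', c i (z + ∑ b ∈ B', e b) a ≠ 0 := by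
  induction L generalizing B with
  | nil => simp
  | cons j L ih =>
    rw [List.map_cons, List.prod_cons, Module.End.mul_apply, edgeOperator_apply,
      Finset.mul_sum] at h
    obtain ⟨a, -, ha⟩ := Finset.exists_ne_zero_of_sum_ne_zero h
    have haB : a ∉ B := by
      intro haB
      apply ha
      rw [← Finset.mul_prod_erase B ε haB]
      linear_combination (c j (z + ∑ b ∈ B, e b) a *
        (L.map fun i => edgeOperator ε e (c i)).prod 1 (z + ∑ b ∈ B, e b + e a) *
        ∏ b ∈ B.erase a, ε b) * hε a
    intro i hi
    rcases List.mem_cons.1 hi with rfl | hi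
    · refine ⟨B, a, haB, fun h0 => ha ?_⟩
      rw [h0]; ring
    · refine ih (insert a B) (fun h0 => ha ?_) i hi
      rw [Finset.prod_insert haB, Finset.sum_insert haB, add_comm (e a), ← add_assoc] at h0
      linear_combination c j (z + ∑ b ∈ B, e b) a * h0

end Lattice

theorem sum_single_apply_eq_ite {ι R : Type*} [DecidableEq ι] [AddCommMonoidWithOne R]
    (B : Finset ι) (a : ι) :
    (∑ b ∈ B, Pi.single b (1 : R) : ι → R) a = if a ∈ B then 1 else 0 := by
  simp [Finset.sum_apply, Pi.single_apply]

section Cube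

variable {ι : Type u} [Fintype ι] [DecidableEq ι]

theorem prod_edgeOperator_single_apply {Λ : Type*} [CommRing Λ] {N : ℕ} (ε : ι → Λ) (L : List ι)
    (hL : L.Nodup) (z : ι → ZMod (N + 1)) :
    (L.map fun i => edgeOperator ε (fun a => Pi.single a (1 : ZMod (N + 1)))
      fun z a => if a = i ∧ z i = -1 then 1 else 0).prod 1 z =
      (L.map fun i => if z i = -1 then ε i else 0).prod := by
  induction L generalizing z with
  | nil => simp
  | cons i L ih =>
    obtain ⟨hi, hL⟩ := List.nodup_cons.1 hL
    rw [List.map_cons, List.prod_cons, Module.End.mul_apply, edgeOperator_apply,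
      Finset.sum_eq_single i (fun a _ ha => by simp [ha]) (by simp), ih hL, List.map_cons,
      List.prod_cons]
    congr 1
    · simp
    · congr 1
      refine List.map_congr_left fun j hj => ?_
      have hji : j ≠ i := fun h => hi (h ▸ hj)
      simp [hji]

/-- A cubical Sperner lemma: if `g i` is false on the face `z i = 0` and true on the opposite face
`z i = N` of the grid `{0, …, N} ^ ι`, then some unit cell of the grid has, for each `i`,
vertices at which `g i` is true and vertices at which `g i` is false. -/
theorem exists_cell_of_opposite_faces {N : ℕ} (g : ι → (ι → ZMod (N + 1)) → Prop)
    (h0 : ∀ i z, z i = 0 → ¬ g i z) (h1 : ∀ i z, z i = -1 → g i z) :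
    ∃ z : ι → ZMod (N + 1), (∀ a, z a ≠ -1) ∧ ∀ i,
      (∃ B : Finset ι, g i (z + ∑ b ∈ B, Pi.single b 1)) ∧
      ∃ B : Finset ι, ¬ g i (z + ∑ b ∈ B, Pi.single b 1) := by
  classical
  obtain ⟨Λ, _, ε, h2, hε, hprod⟩ := exists_commRing_sq_zero_prod_ne_zero ι
  let e : ι → ι → ZMod (N + 1) := fun a => Pi.single a 1
  let c : ι → (ι → ZMod (N + 1)) → ι → Λ := fun i z a => if a = i ∧ z i = -1 then 1 else 0
  let u : ι → (ι → ZMod (N + 1)) → Λ := fun i z => if g i z then 1 else 0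
  have hc : ∀ i z a b, c i z a + c i (z + e a) b = c i z b + c i (z + e b) a := by
    intro i z a b
    by_cases ha : a = i <;> by_cases hb : b = i
    · rw [ha, hb]
    · subst ha; simp [c, e, hb, Ne.symm hb]
    · subst hb; simp [c, e, ha, Ne.symm ha]
    · simp [c, ha, hb]
  have hsum := sum_prod_edgeOperator_add_coboundary h2 hε e c hc u Finset.univ.toList
  have hstd : ∑ z, (Finset.univ.toList.map fun i => edgeOperator ε e (c i)).prod 1 z =
      ∏ i, ε i := by
    simp only [c, e, prod_edgeOperator_single_apply ε _ (Finset.nodup_toList _),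
      Finset.prod_map_toList]
    rw [← Fintype.prod_sum fun (i : ι) (x : ZMod (N + 1)) => if x = -1 then ε i else 0]
    simp
  rw [hstd] at hsum
  obtain ⟨z, -, hz⟩ := Finset.exists_ne_zero_of_sum_ne_zero (hsum ▸ hprod)
  have key := exists_ne_zero_of_prod_edgeOperator_ne_zero hε e _ z _ ∅ (by simpa using hz)
  have hcoord (B : Finset ι) (a : ι) :
      (z + ∑ b ∈ B, e b) a = z a + if a ∈ B then 1 else 0 := by
    rw [Pi.add_apply, sum_single_apply_eq_ite]
  have hstep (B : Finset ι) (a : ι) (ha : a ∉ B) :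
      z + ∑ b ∈ B, e b + e a = z + ∑ b ∈ insert a B, e b := by
    rw [Finset.sum_insert ha]; abel
  have hne (a : ι) : z a ≠ -1 := by
    intro hza
    obtain ⟨B, b, hb, h⟩ := key a (by simp)
    apply h
    rw [hstep B b hb]
    have hB := hcoord B a
    have hB' := hcoord (insert b B) a
    rw [hza] at hB hB'
    by_cases hba : b = a
    · subst hba
      simp only [hb, if_false, add_zero, Finset.mem_insert_self, if_true, neg_add_cancel] at hB hB'
      simp [c, u, hB, h1 _ _ hB, h0 _ _ hB', one_add_one_eq_two, h2]
    · by_cases haB : a ∈ B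
      · simp only [haB, if_true, Finset.mem_insert, or_true, neg_add_cancel] at hB hB'
        simp [c, u, hba, h0 _ _ hB, h0 _ _ hB']
      · simp only [haB, if_false, add_zero, Finset.mem_insert, Ne.symm hba, or_self] at hB hB'
        simp [c, u, hba, h1 _ _ hB, h1 _ _ hB', one_add_one_eq_two, h2]
  refine ⟨z, hne, fun i => ?_⟩
  obtain ⟨B, b, hb, h⟩ := key i (by simp)
  rw [hstep B b hb] at h
  have hcz : c i (z + ∑ b ∈ B, e b) b = 0 := by
    refine if_neg ?_
    rintro ⟨rfl, h⟩
    rw [hcoord, if_neg hb, add_zero] at h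
    exact hne _ h
  rw [hcz, zero_add] at h
  by_cases hg : g i (z + ∑ b ∈ B, e b) <;> by_cases hg' : g i (z + ∑ b ∈ insert b B, e b)
  · simp [u, hg, hg', one_add_one_eq_two, h2] at h
  · exact ⟨⟨_, hg⟩, ⟨_, hg'⟩⟩
  · exact ⟨⟨_, hg'⟩, ⟨_, hg⟩⟩
  · simp [u, hg, hg'] at h

end Cube

/-- A unit cell of a fine grid almost contains a fixed point of `F`. -/
theorem exists_almost_fixed {ι : Type u} [Fintype ι] {F : ι → (ι → Set.Icc (0 : ℝ) 1) → ℝ}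
    (hF : ∀ i x, F i x ∈ Set.Icc (0 : ℝ) 1) (n : ℕ) :
    ∃ x : ι → Set.Icc (0 : ℝ) 1, ∀ i, ∃ p q : ι → Set.Icc (0 : ℝ) 1,
      dist p x ≤ 1 / ((n : ℝ) + 1) ∧ dist q x ≤ 1 / ((n : ℝ) + 1) ∧ F i p ≤ p i ∧ q i ≤ F i q := by
  classical
  have hn : (0 : ℝ) < n + 1 := by positivity
  let x : (ι → ZMod (n + 1 + 1)) → ι → Set.Icc (0 : ℝ) 1 := fun z a =>
    ⟨(z a).val / ((n : ℝ) + 1), by positivity, by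
      rw [div_le_one hn]
      exact_mod_cast Nat.le_of_lt_succ (ZMod.val_lt (z a))⟩
  have hval : (-1 : ZMod (n + 1 + 1)).val = n + 1 := ZMod.val_neg_one (n + 1)
  obtain ⟨z, hz, h⟩ := exists_cell_of_opposite_faces (N := n + 1)
    (fun i z => z i = -1 ∨ F i (x z) < x z i)
    (by
      rintro i z hz (h | h)
      · rw [hz] at h
        have := congrArg ZMod.val h
        rw [hval] at this
        simp at this
      · refine absurd h (not_lt.2 ?_)
        simpa [x, hz] using (hF i (x z)).1)
    (fun i z hz => Or.inl hz)
  have hclose (B : Finset ι) : dist (x (z + ∑ b ∈ B, Pi.single b 1)) (x z) ≤ 1 / ((n : ℝ) + 1) := by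
    refine (dist_pi_le_iff (by positivity)).2 fun a => ?_
    have hza : (z a).val < n + 1 := by
      refine lt_of_le_of_ne (Nat.le_of_lt_succ (ZMod.val_lt (z a))) fun h => hz a ?_
      exact ZMod.val_injective _ (h.trans hval.symm)
    have hsucc : (z a + 1).val = (z a).val + 1 := by
      have h1 : (1 : ZMod (n + 1 + 1)).val = 1 := ZMod.val_one'' (by omega)
      rw [ZMod.val_add_of_lt (by omega), h1]
    rw [Subtype.dist_eq, Real.dist_eq]
    simp only [x, Pi.add_apply, sum_single_apply_eq_ite]
    split_ifs
    · rw [hsucc, ← sub_div]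
      push_cast
      rw [add_sub_cancel_left, abs_of_pos (by positivity)]
    · simp only [add_zero, sub_self, abs_zero]; positivity
  refine ⟨x z, fun i => ?_⟩
  obtain ⟨⟨B, hB⟩, ⟨B', hB'⟩⟩ := h i
  refine ⟨_, _, hclose B, hclose B', ?_, not_lt.1 fun h => hB' (Or.inr h)⟩
  rcases hB with hB | hB
  · refine (hF i _).2.trans ?_
    have : ((x (z + ∑ b ∈ B, Pi.single b 1) i : Set.Icc (0 : ℝ) 1) : ℝ) = 1 := by
      simp only [x, hB, hval]
      push_cast
      exact div_self hn.ne'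
    exact this.ge
  · exact hB.le

/-- The Brouwer fixed point theorem for a finite-dimensional cube. -/
theorem exists_fixed_of_continuous {ι : Type u} [Finite ι]
    {F : ι → (ι → Set.Icc (0 : ℝ) 1) → ℝ} (hc : ∀ i, Continuous (F i))
    (hF : ∀ i x, F i x ∈ Set.Icc (0 : ℝ) 1) : ∃ x, ∀ i, F i x = x i := by
  have := Fintype.ofFinite ι
  choose x p q hp hq hFp hFq using exists_almost_fixed hF
  obtain ⟨y, φ, hφ, hy⟩ := CompactSpace.tendsto_subseq x
  have hlim {r : ℕ → ι → Set.Icc (0 : ℝ) 1} (hr : ∀ n, dist (r n) (x n) ≤ 1 / ((n : ℝ) + 1)) :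
      Filter.Tendsto (r ∘ φ) Filter.atTop (nhds y) := by
    refine tendsto_of_tendsto_of_dist hy ?_
    refine squeeze_zero (fun _ => dist_nonneg) (fun n => ?_)
      (tendsto_one_div_add_atTop_nhds_zero_nat.comp hφ.tendsto_atTop)
    rw [dist_comm]
    exact hr (φ n)
  refine ⟨y, fun i => ?_⟩
  have hi : Continuous fun z : ι → Set.Icc (0 : ℝ) 1 => (z i : ℝ) := by fun_prop
  apply le_antisymm
  · exact le_of_tendsto_of_tendsto' (((hc i).tendsto y).comp (hlim fun n => hp n i))
      ((hi.tendsto y).comp (hlim fun n => hp n i)) fun n => hFp _ i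
  · exact le_of_tendsto_of_tendsto' ((hi.tendsto y).comp (hlim fun n => hq n i))
      (((hc i).tendsto y).comp (hlim fun n => hq n i)) fun n => hFq _ i

/-- The Brouwer fixed point theorem for a cube of arbitrary dimension. -/
theorem exists_fixed_of_continuous_of_product {I : Type*}
    {F : I → (I → Set.Icc (0 : ℝ) 1) → ℝ} (hc : ∀ i, Continuous (F i))
    (hF : ∀ i x, F i x ∈ Set.Icc (0 : ℝ) 1) : ∃ x, ∀ i, F i x = x i := by
  classical
  have h := CompactSpace.iInter_nonempty (t := fun i => {x | F i x = x i})
    (fun i => isClosed_eq (hc i) (by fun_prop)) fun s => by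
      let j : (s → Set.Icc (0 : ℝ) 1) → I → Set.Icc (0 : ℝ) 1 := fun x i =>
        if hi : i ∈ s then x ⟨i, hi⟩ else 0
      have hj : Continuous j := continuous_pi fun i => by
        by_cases hi : i ∈ s
        · simpa [j, hi] using continuous_apply _
        · simpa [j, hi] using continuous_const
      obtain ⟨x, hx⟩ := exists_fixed_of_continuous (ι := s)
        (F := fun i x => F i (j x))
        (fun i => (hc i).comp hj) fun i x => hF i _
      refine ⟨j x, Set.mem_iInter₂.2 fun i hi => ?_⟩
      rw [Set.mem_ofPred_eq, hx ⟨i, hi⟩]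
      simp [j, hi]
  exact ⟨h.some, Set.mem_iInter.1 h.some_mem⟩

theorem eventually_subset_of_setValuedUsc {X : Type*} [TopologicalSpace X] {T : X → Set ℝ}
    (hT : SetValuedUsc T) {V : Set ℝ} (hV : IsOpen V) {x : X} (hx : T x ⊆ V) :
    ∀ᶠ y in nhds x, T y ⊆ V := by
  obtain ⟨U, hU, hxU, h⟩ := hT x V hV hx
  exact Filter.mem_of_superset (hU.mem_nhds hxU) h

theorem isOpen_setOf_subset_Iio {X : Type*} [TopologicalSpace X] {T : X → Set ℝ}
    (hT : SetValuedUsc T) (hc : ∀ x, IsCompact (T x)) {f : X → ℝ} (hf : Continuous f) :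
    IsOpen {x | T x ⊆ Set.Iio (f x)} := by
  refine isOpen_iff_mem_nhds.2 fun x hx => ?_
  obtain ⟨c, hcx, hTc⟩ : ∃ c < f x, T x ⊆ Set.Iio c := by
    rcases (T x).eq_empty_or_nonempty with he | hne
    · exact ⟨f x - 1, by linarith, by simp [he]⟩
    · obtain ⟨m, hm, hmax⟩ := (hc x).exists_isGreatest hne
      obtain ⟨c, hmc, hcx⟩ := exists_between (Set.mem_Iio.1 (hx hm))
      exact ⟨c, hcx, fun t ht => (hmax ht).trans_lt hmc⟩
  filter_upwards [eventually_subset_of_setValuedUsc hT isOpen_Iio hTc,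
    hf.continuousAt.eventually (lt_mem_nhds hcx)] with y hy hcy t ht
  exact (hy ht).trans hcy

theorem isOpen_setOf_subset_Ioi {X : Type*} [TopologicalSpace X] {T : X → Set ℝ}
    (hT : SetValuedUsc T) (hc : ∀ x, IsCompact (T x)) {f : X → ℝ} (hf : Continuous f) :
    IsOpen {x | T x ⊆ Set.Ioi (f x)} := by
  refine isOpen_iff_mem_nhds.2 fun x hx => ?_
  obtain ⟨c, hcx, hTc⟩ : ∃ c > f x, T x ⊆ Set.Ioi c := by
    rcases (T x).eq_empty_or_nonempty with he | hne
    · exact ⟨f x + 1, by linarith, by simp [he]⟩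
    · obtain ⟨m, hm, hmin⟩ := (hc x).exists_isLeast hne
      obtain ⟨c, hxc, hcm⟩ := exists_between (Set.mem_Ioi.1 (hx hm))
      exact ⟨c, hxc, fun t ht => hcm.trans_le (hmin ht)⟩
  filter_upwards [eventually_subset_of_setValuedUsc hT isOpen_Ioi hTc,
    hf.continuousAt.eventually (gt_mem_nhds hcx)] with y hy hcy t ht
  exact lt_trans hcy (hy ht)

theorem Convex.subset_Iio_or_subset_Ioi {s : Set ℝ} (hs : Convex ℝ s) {c : ℝ} (hc : c ∉ s) :
    s ⊆ Set.Iio c ∨ s ⊆ Set.Ioi c := by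
  by_contra! h
  obtain ⟨⟨a, ha, hac⟩, ⟨b, hb, hbc⟩⟩ := And.imp Set.not_subset.1 Set.not_subset.1 h
  exact hc (hs.ordConnected.out hb ha ⟨not_lt.1 hbc, not_lt.1 hac⟩)

/-- Equilibrium existence for qualitative games: if each preference
correspondence `P i` on the product `∏ [0,1]` is usc with (possibly empty) closed
convex values in `[0,1]`, has perfectly normal domain `{x : P i x ≠ ∅}`, and is
irreflexive (`x i ∉ P i x`), then the game has an equilibrium `y` (all `P i y = ∅`). -/
theorem qualitative_game_equilibrium
    {I : Type*} (P : I → (I → Set.Icc (0 : ℝ) 1) → Set ℝ)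
    (hPusc : ∀ i, SetValuedUsc (P i))
    (hPsub : ∀ i x, P i x ⊆ Set.Icc (0 : ℝ) 1)
    (hPcl : ∀ i x, IsClosed (P i x))
    (hPconv : ∀ i x, Convex ℝ (P i x))
    (hdom : ∀ i, PerfectlyNormalSpace {x : I → Set.Icc (0 : ℝ) 1 // (P i x).Nonempty})
    (hirr : ∀ i, ∀ x : I → Set.Icc (0 : ℝ) 1, (x i : ℝ) ∉ P i x) :
    ∃ y : I → Set.Icc (0 : ℝ) 1, ∀ i, P i y = ∅ := by
  have hcomp (i x) : IsCompact (P i x) := isCompact_Icc.of_isClosed_subset (hPcl i x) (hPsub i x)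
  have hside (i x) : P i x ⊆ Set.Iio (x i : ℝ) ∨ P i x ⊆ Set.Ioi (x i : ℝ) :=
    (hPconv i x).subset_Iio_or_subset_Ioi (hirr i x)
  have hF (i : I) : ∃ f : C(I → Set.Icc (0 : ℝ) 1, ℝ), (∀ x, f x ∈ Set.Icc (0 : ℝ) 1) ∧
      ∀ x, f x = x i → P i x = ∅ := by
    have hcont : Continuous fun x : I → Set.Icc (0 : ℝ) 1 => (x i : ℝ) := by fun_prop
    obtain ⟨f, hf0, hf1, hf⟩ := exists_continuous_zero_one_of_isClosed
      (isOpen_setOf_subset_Ioi (hPusc i) (hcomp i) hcont).isClosed_compl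
      (isOpen_setOf_subset_Iio (hPusc i) (hcomp i) hcont).isClosed_compl
      (Set.disjoint_left.2 fun x h h' => (hside i x).elim h' h)
    refine ⟨f, hf, fun x hx => Set.eq_empty_of_forall_notMem fun t ht => ?_⟩
    have htI := hPsub i x ht
    rcases hside i x with h | h
    · have hlt : t < x i := h ht
      have : f x = 0 := hf0 fun h' => lt_asymm hlt (h' ht)
      linarith [htI.1]
    · have hlt : (x i : ℝ) < t := h ht
      have : f x = 1 := hf1 fun h' => lt_asymm hlt (h' ht)
      linarith [htI.2]
  choose f hf hfP using hF
  obtain ⟨y, hy⟩ := exists_fixed_of_continuous_of_product (F := fun i => f i)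
    (fun i => (f i).continuous) hf
  exact ⟨y, fun i => hfP i y (hy i)⟩
end

section
/- Let X be a completely normal topological space, A a closed subset of X, and C a subset of A that is closed in A. Then there exists an open subset O of X such that O ∩ A = int_A(C) (the interior of C in the subspace A) and cl_X(O) ∩ A ⊆ C. -/
/-- In a completely normal (Hausdorff) space `X`, for a closed set
`A` and a set `C ⊆ A` closed in the subspace `A`, there is an open `O ⊆ X` with
`O ∩ A = int_A(C)` and `cl_X(O) ∩ A ⊆ C`. -/
theorem relative_interior_open_approx_of_completelyNormal
    {X : Type*} [TopologicalSpace X] [T5Space X]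
    {A : Set X} (hA : IsClosed A) {C : Set X} (hCA : C ⊆ A)
    (hC : IsClosed ((Subtype.val : A → X) ⁻¹' C)) :
    ∃ O : Set X, IsOpen O ∧
      O ∩ A = Subtype.val '' interior ((Subtype.val : A → X) ⁻¹' C) ∧
      closure O ∩ A ⊆ C := by
  have hC' : IsClosed C := by
    simpa [Subtype.image_preimage_coe, Set.inter_eq_right.mpr hCA] using
      hA.isClosedEmbedding_subtypeVal.isClosedMap _ hC
  obtain ⟨W, hW, hWi⟩ := isOpen_induced_iff.mp
    (isOpen_interior (s := (Subtype.val : A → X) ⁻¹' C))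
  rw [← hWi, Subtype.image_preimage_coe]
  have hWC : A ∩ W ⊆ C := by
    rintro x ⟨hxA, hxW⟩
    have hx : (⟨x, hxA⟩ : A) ∈ interior ((Subtype.val : A → X) ⁻¹' C) := hWi ▸ hxW
    exact (interior_subset hx : (⟨x, hxA⟩ : A) ∈ (Subtype.val : A → X) ⁻¹' C)
  have hWT : Disjoint W (closure (A \ C)) :=
    Disjoint.closure_right
      (Set.disjoint_left.mpr fun x hxW hx => hx.2 (hWC ⟨hx.1, hxW⟩)) hW
  obtain ⟨U, V, hU, hV, hSU, hTV, hUV⟩ := separatedNhds_iff_disjoint.mpr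
    (CompletelyNormalSpace.completely_normal (s := A ∩ W) (t := A \ C)
      (Set.disjoint_left.mpr fun x hx hxT => hxT.2 (closure_minimal hWC hC' hx))
      (hWT.mono_left Set.inter_subset_right))
  refine ⟨U ∩ W, hU.inter hW, ?_, ?_⟩
  · ext x
    exact ⟨fun hx => ⟨hx.2, hx.1.2⟩, fun hx => ⟨⟨hSU hx, hx.2⟩, hx.1⟩⟩
  · rintro x ⟨hxO, hxA⟩
    by_contra hxC
    exact Set.disjoint_left.mp (hUV.closure_left hV)
      (closure_mono Set.inter_subset_left hxO) (hTV ⟨hxA, hxC⟩)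
end

section
/- Let X be a normal Hausdorff topological space and A a closed subset of X such that A (with the subspace topology) is perfectly normal. Let C be a subset of A that is closed in A. Then there exists an open subset O of X such that O ∩ A = int_A(C) (the interior of C in the subspace A) and cl_X(O) ∩ A ⊆ C. -/
/-- In a normal Hausdorff space `X`, for a closed set `A` whose
subspace topology is perfectly normal, and a set `C ⊆ A` closed in the subspace `A`,
there is an open `O ⊆ X` with `O ∩ A = int_A(C)` and `cl_X(O) ∩ A ⊆ C`. -/
theorem relative_interior_open_approx_of_normal_of_perfectlyNormal_subset
    {X : Type*} [TopologicalSpace X] [T2Space X] [NormalSpace X]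
    {A : Set X} (hA : IsClosed A) [T6Space A] {C : Set X} (hCA : C ⊆ A)
    (hC : IsClosed ((Subtype.val : A → X) ⁻¹' C)) :
    ∃ O : Set X, IsOpen O ∧
      O ∩ A = Subtype.val '' interior ((Subtype.val : A → X) ⁻¹' C) ∧
      closure O ∩ A ⊆ C := by
  have zero_set : ∀ s : Set A, IsClosed s → ∃ f : C(A, ℝ), s = f ⁻¹' {0} ∧ ∀ x, 0 ≤ f x := by
    intro s hs
    obtain ⟨f, hf, h01⟩ := perfectlyNormalSpace_iff_forall_isClosed_preimage_zero.mp inferInstance s hs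
    exact ⟨f, hf, fun x => (h01 x).1⟩
  obtain ⟨f, hf, hf0⟩ := zero_set _ hC
  obtain ⟨g, hg, hg0⟩ := zero_set _
    (isOpen_interior (s := (Subtype.val : A → X) ⁻¹' C)).isClosed_compl
  have hf' : ∀ a : A, (a : X) ∈ C ↔ f a = 0 := fun a => Set.ext_iff.mp hf a
  have hg' : ∀ a : A, a ∉ interior ((Subtype.val : A → X) ⁻¹' C) ↔ g a = 0 :=
    fun a => Set.ext_iff.mp hg a
  -- A Tietze extension of `g - f` is positive exactly on the relative interior of `C` in `A`,
  -- and negative on `A \ C`.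
  obtain ⟨H, hH⟩ := ContinuousMap.exists_restrict_eq hA (g - f)
  have hHA : ∀ a : A, H a = g a - f a := fun a => DFunLike.congr_fun hH a
  refine ⟨{x | 0 < H x}, isOpen_lt continuous_const H.continuous, ?_, ?_⟩
  · ext x
    constructor
    · rintro ⟨hx, hxA⟩
      refine ⟨⟨x, hxA⟩, ?_, rfl⟩
      by_contra hn
      have h1 := hHA ⟨x, hxA⟩
      have h2 := (hg' _).mp hn
      have h3 := hf0 ⟨x, hxA⟩
      have h4 : 0 < H x := hx
      linarith
    · rintro ⟨a, ha, rfl⟩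
      refine ⟨?_, a.2⟩
      have h1 := (hf' a).mp (interior_subset (s := (Subtype.val : A → X) ⁻¹' C) ha)
      have h2 : g a ≠ 0 := fun h => (hg' a).mpr h ha
      have h3 := (hg0 a).lt_of_ne' h2
      change 0 < H a
      rw [hHA, h1]
      linarith
  · rintro x ⟨hx, hxA⟩
    by_contra hn
    have h0 : 0 ≤ H x :=
      closure_lt_subset_le continuous_const H.continuous hx
    have h1 := hHA ⟨x, hxA⟩
    have h2 := (hg' ⟨x, hxA⟩).mp fun h =>
      hn (interior_subset (s := (Subtype.val : A → X) ⁻¹' C) h)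
    have h3 := (hf0 ⟨x, hxA⟩).lt_of_ne' fun h => hn ((hf' ⟨x, hxA⟩).mpr h)
    linarith
end

section
/- Let X be a topological space satisfying either (C1) X is completely normal, or (C2) X is normal Hausdorff and A is perfectly normal, where A is a closed subset of X. Let T : A → [0,1] be an upper semicontinuous set-valued map with nonempty closed convex values, and let B denote the set of dyadic rationals in [0,1]. For r ∈ B set A_r = {x ∈ A : ∃ y ∈ T(x), y ≤ r}. Then there exists a family (X_r)_{r∈B} of closed subsets of X such that for all r, s ∈ B: (1) X_r ∩ A = A_r; (2) int_A(A_r) ⊆ int_X(X_r); (3) X_r ⊆ X_s whenever r < s; and X_1 = X. -/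
/-- The set of dyadic rationals in `[0,1]`: numbers of the form `i / 2 ^ n`. -/
def DyadicUnit : Set ℝ := {r | ∃ n i : ℕ, i ≤ 2 ^ n ∧ r = (i : ℝ) / 2 ^ n}

open Set Topology

section MonotoneSelection

variable {ι α : Type*} [Preorder ι] [Lattice α] [BoundedOrder α]

open Classical in
/-- Each new term `y n` is corrected so as to lie above all earlier terms with a smaller index
and below all earlier terms with a larger index. -/
noncomputable def monotoneCorrection (q : ℕ → ι) (y : ℕ → α) (n : ℕ) : α :=
  ((Finset.univ.filter fun k : Fin n => q k ≤ q n).sup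
      (fun k => monotoneCorrection q y k.1) ⊔ y n) ⊓
    (Finset.univ.filter fun k : Fin n => q n ≤ q k).inf
      (fun k => monotoneCorrection q y k.1)
termination_by n
decreasing_by all_goals exact k.2

theorem monotoneCorrection_le_of_lt (q : ℕ → ι) (y : ℕ → α) {k n : ℕ} (hkn : k < n)
    (h : q n ≤ q k) : monotoneCorrection q y n ≤ monotoneCorrection q y k := by
  classical
  rw [monotoneCorrection.eq_def q y n]
  exact inf_le_right.trans
    (Finset.inf_le (f := fun k : Fin n => monotoneCorrection q y k.1)
      (b := (⟨k, hkn⟩ : Fin n)) (by simpa using h))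

theorem monotoneCorrection_ge_of_lt (q : ℕ → ι) (y : ℕ → α) {k n : ℕ} (hkn : k < n)
    (h : q k ≤ q n) : monotoneCorrection q y k ≤ monotoneCorrection q y n := by
  classical
  induction n using Nat.strong_induction_on generalizing k with
  | _ n ih =>
    rw [monotoneCorrection.eq_def q y n]
    refine le_inf (le_sup_of_le_left
      (Finset.le_sup (f := fun k : Fin n => monotoneCorrection q y k.1)
        (b := (⟨k, hkn⟩ : Fin n)) (by simpa using h))) (Finset.le_inf fun l hl => ?_)
    have hkl : q k ≤ q l := h.trans (by simpa using hl)
    rcases lt_trichotomy k l with hlt | heq | hgt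
    · exact ih l l.2 hlt hkl
    · rw [heq]
    · exact monotoneCorrection_le_of_lt q y hgt hkl

theorem monotoneCorrection_mono (q : ℕ → ι) (y : ℕ → α) {k n : ℕ} (h : q k ≤ q n) :
    monotoneCorrection q y k ≤ monotoneCorrection q y n := by
  rcases lt_trichotomy k n with hlt | rfl | hgt
  · exact monotoneCorrection_ge_of_lt q y hlt h
  · exact le_rfl
  · exact monotoneCorrection_le_of_lt q y hgt h

theorem monotoneCorrection_spec {p : ι → α → Prop}
    (hsup : ∀ ⦃i j a b⦄, i ≤ j → p i a → p j b → p j (a ⊔ b))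
    (hinf : ∀ ⦃i j a b⦄, i ≤ j → p i a → p j b → p i (a ⊓ b))
    {q : ℕ → ι} {y : ℕ → α} (hy : ∀ n, p (q n) (y n)) (n : ℕ) :
    p (q n) (monotoneCorrection q y n) := by
  classical
  induction n using Nat.strong_induction_on with
  | _ n ih =>
    have sup_mem : ∀ (s : Finset (Fin n)) (b : α), (∀ k ∈ s, q k ≤ q n) → p (q n) b →
        p (q n) (s.sup (fun k => monotoneCorrection q y k.1) ⊔ b) := by
      intro s b hs hb
      induction s using Finset.induction_on with
      | empty => simpa using hb
      | insert k s _ ihs =>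
        rw [Finset.sup_insert, sup_assoc]
        exact hsup (hs k (by simp)) (ih k k.2)
          (ihs fun l hl => hs l (Finset.mem_insert_of_mem hl))
    have inf_mem : ∀ (s : Finset (Fin n)) (b : α), (∀ k ∈ s, q n ≤ q k) → p (q n) b →
        p (q n) (b ⊓ s.inf (fun k => monotoneCorrection q y k.1)) := by
      intro s b hs hb
      induction s using Finset.induction_on with
      | empty => simpa using hb
      | insert k s _ ihs =>
        rw [Finset.inf_insert, inf_left_comm, inf_comm]
        exact hinf (hs k (by simp))
          (ihs fun l hl => hs l (Finset.mem_insert_of_mem hl)) (ih k k.2)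
    rw [monotoneCorrection.eq_def q y n]
    exact inf_mem _ _ (by simp) (sup_mem _ _ (by simp) (hy n))

/-- A countable family of nonempty constraints in a lattice which is compatible with suprema and
infima admits a monotone selection. -/
theorem exists_monotone_selection [Countable ι] {p : ι → α → Prop} (hne : ∀ i, ∃ a, p i a)
    (hsup : ∀ ⦃i j a b⦄, i ≤ j → p i a → p j b → p j (a ⊔ b))
    (hinf : ∀ ⦃i j a b⦄, i ≤ j → p i a → p j b → p i (a ⊓ b)) :
    ∃ z : ι → α, Monotone z ∧ ∀ i, p i (z i) := by
  rcases isEmpty_or_nonempty ι with _ | _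
  · exact ⟨isEmptyElim, fun i => isEmptyElim i, fun i => isEmptyElim i⟩
  obtain ⟨q, hq⟩ := exists_surjective_nat ι
  choose y hy using hne
  choose g hg using hq
  refine ⟨fun i => monotoneCorrection q (fun n => y (q n)) (g i), fun i j hij => ?_, fun i => ?_⟩
  · exact monotoneCorrection_mono q _ (by simpa only [hg] using hij)
  · simpa only [hg] using monotoneCorrection_spec hsup hinf (q := q) (fun n => hy (q n)) (g i)

end MonotoneSelection

section Extension

variable {X : Type*} [TopologicalSpace X] {A : Set X}

theorem IsOpen.hasSeparatingCover_image_val [NormalSpace X] [PerfectlyNormalSpace A]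
    (hA : IsClosed A) {U : Set A} (hU : IsOpen U) {t : Set X}
    (h : Disjoint (Subtype.val '' U) (closure t)) :
    HasSeparatingCover (Subtype.val '' U) t := by
  obtain ⟨f, hfo, hf⟩ := hU.isClosed_compl.isGδ.eq_iInter_nat
  have hUf : U = ⋃ n, (f n)ᶜ := by rw [← compl_iInter, ← hf, compl_compl]
  have key : ∀ n, ∃ u : Set X, IsOpen u ∧ Subtype.val '' (f n)ᶜ ⊆ u ∧
      closure u ⊆ (closure t)ᶜ := fun n =>
    normal_exists_closure_subset
      (hA.isClosedEmbedding_subtypeVal.isClosedMap _ (hfo n).isClosed_compl)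
      isClosed_closure.isOpen_compl
      ((image_mono (hUf ▸ subset_iUnion (fun n => (f n)ᶜ) n)).trans h.subset_compl_right)
  choose u huo hfu hut using key
  refine ⟨u, ?_, fun n => ⟨huo n, ?_⟩⟩
  · rw [hUf, image_iUnion]
    exact iUnion_mono hfu
  · exact (disjoint_compl_left.mono_left (hut n)).mono_right subset_closure

theorem Subtype.disjoint_image_val_closure_image_val {U V : Set A} (hU : IsOpen U)
    (h : Disjoint U V) : Disjoint (Subtype.val '' U) (closure (Subtype.val '' V)) := by
  rw [disjoint_left]
  rintro _ ⟨a, ha, rfl⟩ hcl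
  exact disjoint_left.1 (h.closure_right hU) ha (closure_subtype.2 hcl)

theorem separatedNhds_image_val (hA : IsClosed A)
    (hcond : CompletelyNormalSpace X ∨ (NormalSpace X ∧ PerfectlyNormalSpace A))
    {U V : Set A} (hU : IsOpen U) (hV : IsOpen V) (h : Disjoint U V) :
    SeparatedNhds (Subtype.val '' U : Set X) (Subtype.val '' V) := by
  have hUV := Subtype.disjoint_image_val_closure_image_val hU h
  have hVU := Subtype.disjoint_image_val_closure_image_val hV h.symm
  rcases hcond with _ | ⟨_, _⟩
  · exact separatedNhds_iff_disjoint.2 (completely_normal hVU.symm hUV)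
  · exact hasSeparatingCovers_iff_separatedNhds.1
      ⟨hU.hasSeparatingCover_image_val hA hUV, hV.hasSeparatingCover_image_val hA hVU⟩

theorem exists_isClosed_inter_eq_interior_subset (hA : IsClosed A)
    (hcond : CompletelyNormalSpace X ∨ (NormalSpace X ∧ PerfectlyNormalSpace A))
    {F : Set A} (hF : IsClosed F) :
    ∃ Y : Set X, IsClosed Y ∧ Y ∩ A = Subtype.val '' F ∧
      Subtype.val '' interior F ⊆ interior Y := by
  obtain ⟨u, v, huo, hvo, hu, hv, huv⟩ := separatedNhds_image_val hA hcond isOpen_interior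
    hF.isOpen_compl (disjoint_compl_right.mono_left interior_subset)
  refine ⟨Subtype.val '' F ∪ closure u,
    (hA.isClosedEmbedding_subtypeVal.isClosedMap _ hF).union isClosed_closure, ?_, ?_⟩
  · ext x
    refine ⟨?_, fun hx => ⟨Or.inl hx, Subtype.coe_image_subset A F hx⟩⟩
    rintro ⟨hx | hx, hxA⟩
    · exact hx
    · by_contra hxF
      refine disjoint_left.1 (huv.closure_left hvo) hx (hv ⟨⟨x, hxA⟩, fun hmem => ?_, rfl⟩)
      exact hxF ⟨_, hmem, rfl⟩
  · exact hu.trans (interior_maximal (subset_closure.trans subset_union_right) huo)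

end Extension

theorem SetValuedUsc.isClosed_setOf_exists_le {Z : Type*} [TopologicalSpace Z] {T : Z → Set ℝ}
    (hT : SetValuedUsc T) (r : ℝ) : IsClosed {z | ∃ y ∈ T z, y ≤ r} := by
  rw [← isOpen_compl_iff, isOpen_iff_forall_mem_open]
  intro z hz
  obtain ⟨U, hUo, hzU, hU⟩ := hT z (Ioi r) isOpen_Ioi fun y hy =>
    not_le.1 fun hyr => hz ⟨y, hy, hyr⟩
  refine ⟨U, fun w hw => ?_, hUo, hzU⟩
  rintro ⟨y, hy, hyr⟩
  exact not_lt.2 hyr (hU w hw hy)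

theorem DyadicUnit.countable : DyadicUnit.Countable := by
  refine (countable_range fun x : ℕ × ℕ => (x.2 : ℝ) / 2 ^ x.1).mono ?_
  rintro _ ⟨n, i, _, rfl⟩
  exact ⟨(n, i), rfl⟩

theorem DyadicUnit.le_one {r : ℝ} (hr : r ∈ DyadicUnit) : r ≤ 1 := by
  obtain ⟨n, i, hi, rfl⟩ := hr
  rw [div_le_one (by positivity)]
  exact_mod_cast hi

theorem DyadicUnit.one_mem : (1 : ℝ) ∈ DyadicUnit := ⟨0, 1, by simp, by simp⟩

/-- Under (C1) `X` completely normal, or (C2) `X` normal (Hausdorff)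
and the closed subset `A` perfectly normal, for a usc map `T : A → [0,1]` with
nonempty closed convex values, setting `A_r = {x ∈ A : ∃ y ∈ T x, y ≤ r}`, there is
a family `(X_r)` of closed subsets of `X`, indexed by the dyadic rationals `r` of
`[0,1]`, with `X_r ∩ A = A_r`, `int_A(A_r) ⊆ int_X(X_r)`, `X_r ⊆ X_s` for `r < s`,
and `X_1 = X`. -/
theorem dyadic_family_exists
    {X : Type*} [TopologicalSpace X] [T2Space X]
    {A : Set X} (hA : IsClosed A)
    (hcond : CompletelyNormalSpace X ∨ (NormalSpace X ∧ PerfectlyNormalSpace A))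
    (T : A → Set ℝ)
    (hTusc : SetValuedUsc T)
    (hTsub : ∀ a, T a ⊆ Set.Icc (0 : ℝ) 1)
    (hTne : ∀ a, (T a).Nonempty)
    (hTcl : ∀ a, IsClosed (T a))
    (hTconv : ∀ a, Convex ℝ (T a)) :
    ∃ Xr : ℝ → Set X,
      (∀ r ∈ DyadicUnit, IsClosed (Xr r)) ∧
      (∀ r ∈ DyadicUnit,
        Xr r ∩ A = Subtype.val '' {a : A | ∃ y ∈ T a, y ≤ r}) ∧
      (∀ r ∈ DyadicUnit,
        Subtype.val '' interior {a : A | ∃ y ∈ T a, y ≤ r} ⊆ interior (Xr r)) ∧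
      (∀ r ∈ DyadicUnit, ∀ s ∈ DyadicUnit, r < s → Xr r ⊆ Xr s) ∧
      Xr 1 = Set.univ := by
  classical
  let F : ℝ → Set A := fun r => {a : A | ∃ y ∈ T a, y ≤ r}
  have hFmono : Monotone F := fun r s hrs a ⟨y, hy, hyr⟩ => ⟨y, hy, hyr.trans hrs⟩
  have hFone : F 1 = Set.univ := Set.eq_univ_of_forall fun a => by
    obtain ⟨y, hy⟩ := hTne a
    exact ⟨y, hy, (hTsub a hy).2⟩
  let p : DyadicUnit → Set X → Prop := fun r Y =>
    IsClosed Y ∧ Y ∩ A = Subtype.val '' F r ∧ Subtype.val '' interior (F r) ⊆ interior Y ∧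
      (r.1 = 1 → Y = Set.univ)
  have : Countable DyadicUnit := DyadicUnit.countable.to_subtype
  obtain ⟨z, hzmono, hz⟩ := exists_monotone_selection (p := p)
    (by
      rintro ⟨r, hr⟩
      by_cases h1 : r = 1
      · subst h1
        exact ⟨Set.univ, isClosed_univ, by simp [hFone], by simp, fun _ => rfl⟩
      · obtain ⟨Y, hYc, hYA, hYi⟩ := exists_isClosed_inter_eq_interior_subset hA hcond
          (hTusc.isClosed_setOf_exists_le r)
        exact ⟨Y, hYc, hYA, hYi, fun h => absurd h h1⟩)
    (by
      rintro i j a b hij ⟨hac, haA, hai, ha1⟩ ⟨hbc, hbA, hbi, hb1⟩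
      refine ⟨hac.union hbc, ?_, hbi.trans (interior_mono Set.subset_union_right), fun h => ?_⟩
      · change (a ∪ b) ∩ A = _
        rw [Set.union_inter_distrib_right, haA, hbA]
        exact Set.union_eq_right.2 (Set.image_mono (hFmono hij))
      · rw [hb1 h]
        exact Set.union_univ a)
    (by
      rintro i j a b hij ⟨hac, haA, hai, ha1⟩ ⟨hbc, hbA, hbi, hb1⟩
      refine ⟨hac.inter hbc, ?_, ?_, fun h => ?_⟩
      · change (a ∩ b) ∩ A = _
        rw [Set.inter_inter_distrib_right, haA, hbA]
        exact Set.inter_eq_left.2 (Set.image_mono (hFmono hij))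
      · change _ ⊆ interior (a ∩ b)
        rw [interior_inter]
        exact Set.subset_inter hai
          ((Set.image_mono (interior_mono (hFmono hij))).trans hbi)
      · have hj : j.1 = 1 := le_antisymm (DyadicUnit.le_one j.2) (h ▸ hij)
        rw [ha1 h, hb1 hj]
        exact Set.univ_inter Set.univ)
  have hext : ∀ r (hr : r ∈ DyadicUnit),
      (fun r => if h : r ∈ DyadicUnit then z ⟨r, h⟩ else ∅) r = z ⟨r, hr⟩ :=
    fun r hr => dif_pos hr
  refine ⟨fun r => if h : r ∈ DyadicUnit then z ⟨r, h⟩ else ∅, fun r hr => ?_, fun r hr => ?_,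
    fun r hr => ?_, fun r hr s hs hrs => ?_, ?_⟩
  · rw [hext r hr]
    exact (hz ⟨r, hr⟩).1
  · rw [hext r hr]
    exact (hz ⟨r, hr⟩).2.1
  · rw [hext r hr]
    exact (hz ⟨r, hr⟩).2.2.1
  · rw [hext r hr, hext s hs]
    exact hzmono (show (⟨r, hr⟩ : DyadicUnit) ≤ ⟨s, hs⟩ from hrs.le)
  · rw [hext 1 DyadicUnit.one_mem]
    exact (hz ⟨1, DyadicUnit.one_mem⟩).2.2.2 rfl
end
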